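/- Let k ≥ 1 and n ∈ ℕ with 2n ≥ (k/2)² + 3. Fix bounded intervals (a_{ij}, b_{ij}) ⊆ ℝ for 1 ≤ i < j ≤ k, and let g ∈ SL_{2n}(ℝ). Then there exist constants C > 0 and T_0 > 0 depending on g, n, k and the intervals such that for all T ≥ T_0, | ∫_{X_{2n}} χ̃_{E_{g,T}} dμ − vol_{2nk}(E_{g,T}) | ≤ C · T^{2n(k−1) − (k−1)(k−2)}, where χ̃_{E_{g,T}} denotes the rank-k Siegel transform of the characteristic function of E_{g,T} and vol_{2nk} is Lebesgue measure on (ℝ^{2n})^k. -/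

import Mathlib

open Matrix MeasureTheory

noncomputable section

instance (m : ℕ) : MeasurableSpace (Matrix (Fin m) (Fin m) ℝ) := MeasurableSpace.pi

noncomputable instance (m : ℕ) : TopologicalSpace (Matrix.SpecialLinearGroup (Fin m) ℝ) :=
  instTopologicalSpaceSubtype

instance (m : ℕ) : MeasurableSpace (Matrix.SpecialLinearGroup (Fin m) ℝ) :=
  Subtype.instMeasurableSpace

abbrev SLR (m : ℕ) := Matrix.SpecialLinearGroup (Fin m) ℝ

/-- `SL_m(ℤ)`, viewed as a subgroup of `SL_m(ℝ)`. -/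
def SLZ (m : ℕ) : Subgroup (SLR m) :=
  (Matrix.SpecialLinearGroup.map (n := Fin m) (Int.castRingHom ℝ)).range

/-- The space `X_m = SL_m(ℝ)/SL_m(ℤ)`. -/
abbrev Xspace (m : ℕ) := SLR m ⧸ SLZ m

/-- Jordan measurability: bounded with null topological boundary. -/
def JordanMeasurable {k d : ℕ} (S : Set (Fin k → Fin d → ℝ)) : Prop :=
  Bornology.IsBounded S ∧ volume (frontier S) = 0

/-- `vol_r`, with the convention `vol_0 = 1`. -/
def jvol (d r : ℕ) (S : Set (Fin r → Fin d → ℝ)) : ℝ :=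
  if r = 0 then 1 else (volume S).toReal

abbrev Pairs (k : ℕ) := {p : Fin k × Fin k // p.1 < p.2}

/-- The standard symplectic matrix `J_n` with block form `(0 Iₙ; -Iₙ 0)`. -/
def Jmat (n : ℕ) : Matrix (Fin (2*n)) (Fin (2*n)) ℝ :=
  fun i j => if (i : ℕ) + n = (j : ℕ) then 1 else if (j : ℕ) + n = (i : ℕ) then -1 else 0

/-- The standard symplectic form `⟨v,w⟩ = vᵀ Jₙ w` on `ℝ^{2n}`. -/
def symp (n : ℕ) (v w : Fin (2*n) → ℝ) : ℝ := v ⬝ᵥ (Jmat n).mulVec w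

/-- Euclidean norm on `ℝ^d` (presented as `Fin d → ℝ`). -/
def enorm2 {d : ℕ} (v : Fin d → ℝ) : ℝ := Real.sqrt (∑ i, (v i)^2)

/-- The set `E_{g,T}` of tuples `(v_1,…,v_k)` with `⟨v_i,v_j⟩ ∈ (a_{ij},b_{ij})` for
`i < j` and `‖g v_ℓ‖ < T`. -/
def EgT (n k : ℕ) (g : SLR (2*n)) (a b : Pairs k → ℝ) (T : ℝ) :
    Set (Fin k → Fin (2*n) → ℝ) :=
  {v | (∀ p : Pairs k, symp n (v p.1.1) (v p.1.2) ∈ Set.Ioo (a p) (b p)) ∧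
       ∀ l, enorm2 ((g : Matrix (Fin (2*n)) (Fin (2*n)) ℝ).mulVec (v l)) < T}

section

lemma measX {m : ℕ} {β : Type*} [MeasurableSpace β] {f : Xspace m → β}
    (hf : Measurable (fun h : SLR m => f (QuotientGroup.mk h))) : Measurable f :=
  measurable_from_quotient.2 hf

lemma meas_mk {m : ℕ} : Measurable (QuotientGroup.mk : SLR m → Xspace m) :=
  fun _ h => h

lemma meas_SLR {m : ℕ} {α : Type*} [MeasurableSpace α] {f : α → SLR m}
    (h : ∀ i j, Measurable fun a => (f a : Matrix (Fin m) (Fin m) ℝ) i j) : Measurable f :=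
  Measurable.subtype_mk (f := fun a => (f a : Matrix (Fin m) (Fin m) ℝ))
    (measurable_pi_iff.2 fun i => measurable_pi_iff.2 fun j => h i j)

lemma meas_entry {m : ℕ} (i j : Fin m) :
    Measurable fun a : SLR m => (a : Matrix (Fin m) (Fin m) ℝ) i j :=
  (measurable_pi_apply j).comp ((measurable_pi_apply i).comp measurable_subtype_coe)

lemma meas_mul {m : ℕ} {α : Type*} [MeasurableSpace α] {f g : α → SLR m} (hf : Measurable f)
    (hg : Measurable g) : Measurable (fun a => f a * g a) := by
  refine meas_SLR fun i j => ?_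
  simp only [Matrix.SpecialLinearGroup.coe_mul, Matrix.mul_apply]
  exact Finset.measurable_sum _ fun k _ => ((meas_entry i k).comp hf).mul ((meas_entry k j).comp hg)

instance instMM (m : ℕ) : MeasurableMul₂ (SLR m) := ⟨meas_mul measurable_fst measurable_snd⟩

instance instMI (m : ℕ) : MeasurableInv (SLR m) := by
  refine ⟨meas_SLR fun i j => ?_⟩
  simp only [Matrix.SpecialLinearGroup.coe_inv, Matrix.adjugate_apply, Matrix.det_apply]
  refine Finset.measurable_sum _ fun σ _ => Measurable.const_smul
    (Finset.measurable_prod _ fun k _ => ?_) _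
  simp only [Matrix.updateRow_apply]
  split_ifs
  · exact measurable_const
  · exact meas_entry _ _

instance instCZ (m : ℕ) : Countable (SLZ m) := by
  have : (Set.range (Matrix.SpecialLinearGroup.map (n := Fin m) (Int.castRingHom ℝ))).Countable := by
    have : Countable (Matrix (Fin m) (Fin m) ℤ) := inferInstanceAs (Countable (Fin m → Fin m → ℤ))
    have : Countable (Matrix.SpecialLinearGroup (Fin m) ℤ) := Subtype.countable
    exact Set.countable_range _
  exact this.to_subtype

/-- kernel on the quotient -/
def qker {m : ℕ} {ι Y : Type*} [MeasurableSpace Y] (s : SLR m → ι → Y) (x : Xspace m) : Measure Y :=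
  Measure.sum fun i => Measure.dirac (s (Quotient.out x) i)

/-- sum on the quotient -/
def Av {m : ℕ} {ι Y : Type*} (s : SLR m → ι → Y) (F : Y → ENNReal) (x : Xspace m) : ENNReal :=
  ∑' i, F (s (Quotient.out x) i)

def Equivar {m : ℕ} {ι Y : Type*} (s : SLR m → ι → Y) : Prop :=
  ∀ h : SLR m, ∀ γ ∈ SLZ m, ∃ π : Equiv.Perm ι, ∀ i, s (h * γ) i = s h (π i)

lemma Av_mk {m : ℕ} {ι Y : Type*} {s : SLR m → ι → Y} (hs : Equivar s) (F : Y → ENNReal)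
    (h : SLR m) : Av s F (QuotientGroup.mk h) = ∑' i, F (s h i) := by
  obtain ⟨γ, hγ⟩ := QuotientGroup.mk_out_eq_mul (SLZ m) h
  obtain ⟨π, hπ⟩ := hs h γ γ.2
  unfold Av
  rw [hγ]
  simp_rw [hπ]
  exact π.tsum_eq (fun i => F (s h i))

lemma Av_meas {m : ℕ} {ι Y : Type*} [Countable ι] [MeasurableSpace Y] {s : SLR m → ι → Y}
    (hs : Equivar s)
    (hm : ∀ i, Measurable fun h => s h i) {F : Y → ENNReal} (hF : Measurable F) :
    Measurable (Av s F) := by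
  refine measX ?_
  simp_rw [Av_mk hs]
  exact Measurable.tsum fun i => hF.comp (hm i)

lemma qker_lint {m : ℕ} {ι Y : Type*} [MeasurableSpace Y] (s : SLR m → ι → Y)
    {F : Y → ENNReal} (hF : Measurable F) (x : Xspace m) : ∫⁻ y, F y ∂(qker s x) = Av s F x := by
  simp [qker, Av, lintegral_sum_measure, lintegral_dirac' _ hF]

lemma qker_meas {m : ℕ} {ι Y : Type*} [Countable ι] [MeasurableSpace Y] {s : SLR m → ι → Y}
    (hs : Equivar s) (hm : ∀ i, Measurable fun h => s h i) : Measurable (qker s) := by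
  refine Measure.measurable_of_measurable_coe _ fun B hB => ?_
  have : ∀ x, qker s x B = Av s (B.indicator 1) x := fun x => by
    rw [← qker_lint s (measurable_one.indicator hB), lintegral_indicator_one hB]
  simp_rw [this]
  exact Av_meas hs hm (measurable_one.indicator hB)

lemma bind_lint {m : ℕ} {ι Y : Type*} [Countable ι] [MeasurableSpace Y] {s : SLR m → ι → Y}
    (hs : Equivar s) (hm : ∀ i, Measurable fun h => s h i) (μ : Measure (Xspace m))
    {F : Y → ENNReal} (hF : Measurable F) :
    ∫⁻ y, F y ∂(μ.bind (qker s)) = ∫⁻ x, Av s F x ∂μ := by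
  rw [Measure.lintegral_bind (qker_meas hs hm).aemeasurable hF.aemeasurable]
  simp_rw [qker_lint s hF]

def InvM {m : ℕ} (μ : Measure (Xspace m)) : Prop :=
  ∀ γ : SLR m, Measure.map (fun x => γ • x) μ = μ

lemma meas_smulX {m : ℕ} (g : SLR m) : Measurable (fun x : Xspace m => g • x) :=
  measX (meas_mk.comp (measurable_const_mul g))

lemma InvM.lint {m : ℕ} {μ : Measure (Xspace m)} (hμ : InvM μ) (g : SLR m)
    {f : Xspace m → ENNReal} (hf : Measurable f) : ∫⁻ x, f (g • x) ∂μ = ∫⁻ x, f x ∂μ := by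
  conv_rhs => rw [← hμ g]
  rw [lintegral_map hf (meas_smulX g)]

lemma bind_inv {m : ℕ} {ι Y : Type*} [Countable ι] [MeasurableSpace Y] {s : SLR m → ι → Y}
    (hs : Equivar s) (hm : ∀ i, Measurable fun h => s h i) {μ : Measure (Xspace m)} (hμ : InvM μ)
    (g : SLR m) (φ : Y → Y) (hφ : Measurable φ) (h : ∀ h i, s (g * h) i = φ (s h i)) :
    (μ.bind (qker s)).map φ = μ.bind (qker s) := by
  refine Measure.ext_of_lintegral _ fun F hF => ?_
  rw [lintegral_map hF hφ, bind_lint hs hm μ hF, bind_lint hs hm μ (F := fun y => F (φ y)) (hF.comp hφ),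
    ← hμ.lint g (Av_meas hs hm hF)]
  congr 1
  ext x
  induction x using QuotientGroup.induction_on with | _ x =>
  change Av s _ (QuotientGroup.mk x) = Av s F (QuotientGroup.mk (g * x))
  rw [Av_mk hs, Av_mk hs]
  simp [h]

/-- fibre map -/
def sF (m : ℕ) (h : SLR m) (γ : SLZ m) : SLR m := h * γ

lemma sF_eq {m : ℕ} : Equivar (sF m) := fun h γ hγ =>
  ⟨Equiv.mulLeft ⟨γ, hγ⟩, fun i => by simp [sF, mul_assoc]⟩

lemma sF_meas {m : ℕ} (i : SLZ m) : Measurable fun h => sF m h i :=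
  measurable_mul_const (i : SLR m)

lemma SLZ_small {m : ℕ} (γ : SLR m) (hγ : γ ∈ SLZ m)
    (h : ∀ i j, |(γ : Matrix (Fin m) (Fin m) ℝ) i j - (1 : Matrix (Fin m) (Fin m) ℝ) i j| < 1) :
    γ = 1 := by
  obtain ⟨δ, rfl⟩ := hγ
  ext i j
  have := h i j
  have e1 : ((Matrix.SpecialLinearGroup.map (n := Fin m) (Int.castRingHom ℝ) δ : SLR m) :
    Matrix (Fin m) (Fin m) ℝ) i j = ((δ i j : ℤ) : ℝ) := by simp
  have e2 : (1 : Matrix (Fin m) (Fin m) ℝ) i j = (((1 : Matrix (Fin m) (Fin m) ℤ) i j : ℤ) : ℝ) := by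
    simp [Matrix.one_apply]
  rw [e1, e2] at this
  have h3 : δ i j = (1 : Matrix (Fin m) (Fin m) ℤ) i j := by
    norm_cast at this
    have := Int.abs_lt_one_iff.1 this
    linarith
  exact e1.trans ((congrArg (Int.cast : ℤ → ℝ) h3).trans e2.symm)

instance instB (m : ℕ) : BorelSpace (SLR m) := by
  have : BorelSpace (Matrix (Fin m) (Fin m) ℝ) :=
    inferInstanceAs (BorelSpace (Fin m → Fin m → ℝ))
  exact Subtype.borelSpace _

instance instSC (m : ℕ) : SecondCountableTopology (SLR m) := by
  have : SecondCountableTopology (Matrix (Fin m) (Fin m) ℝ) :=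
    inferInstanceAs (SecondCountableTopology (Fin m → Fin m → ℝ))
  exact TopologicalSpace.Subtype.secondCountableTopology _

lemma exists_O (m : ℕ) : ∃ O : Set (Matrix (Fin m) (Fin m) ℝ), IsOpen O ∧ 1 ∈ O ∧
    ∀ A ∈ O, ∀ i j, |A i j - (1 : Matrix (Fin m) (Fin m) ℝ) i j| < 1 := by
  refine ⟨⋂ i, ⋂ j, {A | |A i j - (1 : Matrix (Fin m) (Fin m) ℝ) i j| < 1}, ?_, by simp, ?_⟩
  · refine isOpen_iInter_of_finite fun i => isOpen_iInter_of_finite fun j => ?_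
    exact isOpen_lt (((continuous_id.matrix_elem i j).sub continuous_const).abs) continuous_const
  · intro A hA i j
    simpa using Set.mem_iInter.1 (Set.mem_iInter.1 hA i) j

def adjMul {m : ℕ} (q : SLR m × SLR m) : Matrix (Fin m) (Fin m) ℝ :=
  Matrix.adjugate (q.1 : Matrix (Fin m) (Fin m) ℝ) * (q.2 : Matrix (Fin m) (Fin m) ℝ)

lemma adjMul_cont {m : ℕ} : Continuous (adjMul (m := m)) := by
  apply Continuous.matrix_mul
  · exact (continuous_subtype_val.comp continuous_fst).matrix_adjugate
  · exact continuous_subtype_val.comp continuous_snd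

lemma adjMul_eq {m : ℕ} (h γ : SLR m) : adjMul (h, h * γ) = (γ : Matrix (Fin m) (Fin m) ℝ) := by
  change Matrix.adjugate (h : Matrix (Fin m) (Fin m) ℝ) *
    ((h * γ : SLR m) : Matrix (Fin m) (Fin m) ℝ) = _
  rw [Matrix.SpecialLinearGroup.coe_mul, ← Matrix.mul_assoc, Matrix.adjugate_mul]
  simp

lemma exists_nhd {m : ℕ} (g : SLR m) : ∃ U : Set (SLR m), IsOpen U ∧ g ∈ U ∧
    ∀ h ∈ U, ∀ γ ∈ SLZ m, h * γ ∈ U → γ = 1 := by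
  obtain ⟨O, hO, h1, h2⟩ := exists_O m
  have hg : (g, g) ∈ adjMul ⁻¹' O := by
    have := adjMul_eq g 1
    rw [mul_one] at this
    rw [Set.mem_preimage, this]
    exact h1
  obtain ⟨U, V, hU, hV, hgU, hgV, hUV⟩ := isOpen_prod_iff.1 (hO.preimage adjMul_cont) g g hg
  refine ⟨U ∩ V, hU.inter hV, ⟨hgU, hgV⟩, fun h hh γ hγ hhγ => SLZ_small γ hγ ?_⟩
  have h3 : (h, h * γ) ∈ adjMul ⁻¹' O := hUV (Set.mk_mem_prod hh.1 hhγ.2)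
  rw [Set.mem_preimage, adjMul_eq] at h3
  exact h2 _ h3

lemma exists_cover (m : ℕ) : ∃ U : ℕ → Set (SLR m), (∀ n, MeasurableSet (U n)) ∧
    (⋃ n, U n = Set.univ) ∧ ∀ n, ∀ h ∈ U n, ∀ γ ∈ SLZ m, h * γ ∈ U n → γ = 1 := by
  choose U hU hg hγ using fun g : SLR m => exists_nhd g
  obtain ⟨s, hs, hs'⟩ := TopologicalSpace.countable_cover_nhds fun g => (hU g).mem_nhds (hg g)
  have hne : s.Nonempty := by
    by_contra hh
    rw [Set.not_nonempty_iff_eq_empty] at hh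
    subst hh
    simp at hs'
    exact Set.empty_ne_univ (α := SLR m) hs'
  obtain ⟨e, rfl⟩ := hs.exists_eq_range hne
  refine ⟨fun n => U (e n), fun n => (hU _).measurableSet, by simpa using hs', fun n => hγ _⟩

lemma cnt_le_one {m : ℕ} {U : Set (SLR m)} (hU : ∀ h ∈ U, ∀ γ ∈ SLZ m, h * γ ∈ U → γ = 1)
    (x : Xspace m) : Av (sF m) (U.indicator 1) x ≤ 1 := by
  induction x using QuotientGroup.induction_on with | _ h =>
  rw [Av_mk sF_eq]
  by_cases hh : ∃ γ : SLZ m, h * γ ∈ U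
  · obtain ⟨γ, hγ⟩ := hh
    rw [tsum_eq_single γ]
    · exact Set.indicator_le_self' (by simp) _
    · intro δ hδ
      apply Set.indicator_of_notMem
      intro h2
      apply hδ
      have := hU _ hγ (γ⁻¹ * δ : SLZ m) (SetLike.coe_mem _) (by simpa [sF] using h2)
      have h3 : (γ⁻¹ * δ : SLZ m) = 1 := Subtype.ext this
      exact (inv_mul_eq_one.1 h3).symm
  · push Not at hh
    have : ∀ γ : SLZ m, U.indicator (1 : SLR m → ENNReal) (sF m h γ) = 0 := fun γ =>
      Set.indicator_of_notMem (hh γ) _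
    simp [this]

def muLift {m : ℕ} (μ : Measure (Xspace m)) : Measure (SLR m) := μ.bind (qker (sF m))

lemma muLift_U {m : ℕ} (μ : Measure (Xspace m)) [IsProbabilityMeasure μ] {U : Set (SLR m)}
    (hm : MeasurableSet U) (hU : ∀ h ∈ U, ∀ γ ∈ SLZ m, h * γ ∈ U → γ = 1) : muLift μ U ≤ 1 := by
  rw [← lintegral_indicator_one hm, muLift, bind_lint sF_eq sF_meas μ (measurable_one.indicator hm)]
  calc _ ≤ ∫⁻ x, 1 ∂μ := lintegral_mono fun x => cnt_le_one hU x
    _ = 1 := by simp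

instance instSF {m : ℕ} (μ : Measure (Xspace m)) [IsProbabilityMeasure μ] :
    SigmaFinite (muLift μ) := by
  obtain ⟨U, h1, h2, h3⟩ := exists_cover m
  exact ⟨⟨⟨U, fun _ => trivial, fun n => (muLift_U μ (h1 n) (h3 n)).trans_lt ENNReal.one_lt_top, h2⟩⟩⟩

lemma muLift_inv {m : ℕ} {μ : Measure (Xspace m)} (hμ : InvM μ) :
    (muLift μ).IsMulLeftInvariant :=
  ⟨fun g => bind_inv sF_eq sF_meas hμ g _ (measurable_const_mul g)
    fun h i => by simp [sF, mul_assoc]⟩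

lemma exists_psi (m : ℕ) : ∃ ψ : SLR m → ENNReal, Measurable ψ ∧ ∀ x, Av (sF m) ψ x = 1 := by
  obtain ⟨U, h1, h2, h3⟩ := exists_cover m
  let w : SLR m → ENNReal := fun h => ∑' n, (2⁻¹ : ENNReal) ^ n * (U n).indicator 1 h
  have hw : Measurable w := Measurable.tsum fun n =>
    (measurable_one.indicator (h1 n)).const_mul _
  have hP : ∀ x, Av (sF m) w x ≤ 2 := fun x => by
    unfold Av
    simp only [w]
    rw [ENNReal.tsum_comm]
    simp_rw [ENNReal.tsum_mul_left]
    calc _ ≤ ∑' n, (2⁻¹ : ENNReal) ^ n * 1 := ENNReal.tsum_le_tsum fun n =>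
          mul_le_mul_right (cnt_le_one (h3 n) x) _
      _ = 2 := by simp [ENNReal.tsum_geometric]
  have hw0 : ∀ h, w h ≠ 0 := fun h => by
    obtain ⟨n, hn⟩ := Set.mem_iUnion.1 (h2 ▸ Set.mem_univ h : h ∈ ⋃ n, U n)
    intro h0
    have := ENNReal.tsum_eq_zero.1 h0 n
    simp [hn] at this
  have hP0 : ∀ x, Av (sF m) w x ≠ 0 := fun x h0 => by
    have := ENNReal.tsum_eq_zero.1 h0 1
    exact hw0 _ this
  refine ⟨fun h => w h / Av (sF m) w (QuotientGroup.mk h),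
    hw.div ((Av_meas sF_eq sF_meas hw).comp meas_mk), fun x => ?_⟩
  have e : ∀ γ : SLZ m, (QuotientGroup.mk (sF m (Quotient.out x) γ) : Xspace m) = x := fun γ => by
    conv_rhs => rw [← QuotientGroup.out_eq' x]
    simp [sF, Quotient.out]
  rw [Av]
  simp_rw [e, div_eq_mul_inv]
  rw [ENNReal.tsum_mul_right]
  exact ENNReal.mul_inv_cancel (hP0 x) ((hP x).trans_lt (by simp)).ne

lemma lift_recover {m : ℕ} (μ : Measure (Xspace m)) {ψ : SLR m → ENNReal} (hψ : Measurable ψ)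
    (h1 : ∀ x, Av (sF m) ψ x = 1) {f : Xspace m → ENNReal} (hf : Measurable f) :
    ∫⁻ h, f (QuotientGroup.mk h) * ψ h ∂(muLift μ) = ∫⁻ x, f x ∂μ := by
  rw [muLift, bind_lint sF_eq sF_meas μ (F := fun h => f (QuotientGroup.mk h) * ψ h)
    ((hf.comp meas_mk).mul hψ)]
  congr 1
  ext x
  have e : ∀ γ : SLZ m, (QuotientGroup.mk (sF m (Quotient.out x) γ) : Xspace m) = x := fun γ => by
    conv_rhs => rw [← QuotientGroup.out_eq' x]
    simp [sF, Quotient.out]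
  rw [Av]
  simp_rw [e]
  rw [ENNReal.tsum_mul_left]
  have := h1 x
  rw [Av] at this
  rw [this, mul_one]

theorem invX_unique {m : ℕ} (μ ν : Measure (Xspace m)) [IsProbabilityMeasure μ]
    [IsProbabilityMeasure ν] (hμ : InvM μ) (hν : InvM ν) : μ = ν := by
  obtain ⟨ψ, hψ, hψ1⟩ := exists_psi m
  have := muLift_inv hμ
  have := muLift_inv hν
  have hne : muLift ν ≠ 0 := by
    intro h0
    have := lift_recover ν hψ hψ1 (f := fun _ => 1) measurable_const
    simp [h0] at this
  obtain ⟨U, u1, u2, u3⟩ := exists_cover m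
  have : ∃ n, muLift ν (U n) ≠ 0 := by
    by_contra! hh
    apply hne
    rw [← Measure.measure_univ_eq_zero, ← u2]
    exact measure_iUnion_null hh
  obtain ⟨n, hn⟩ := this
  have key := measure_eq_div_smul (muLift μ) (muLift ν) hn
    ((muLift_U ν (u1 n) (u3 n)).trans_lt ENNReal.one_lt_top).ne
  set c := muLift μ (U n) / muLift ν (U n)
  have h2 : ∀ f : Xspace m → ENNReal, Measurable f → ∫⁻ x, f x ∂μ = c * ∫⁻ x, f x ∂ν := by
    intro f hf
    rw [← lift_recover μ hψ hψ1 hf, ← lift_recover ν hψ hψ1 hf, key, lintegral_smul_measure,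
      smul_eq_mul]
  have hc : c = 1 := by
    have := h2 (fun _ => 1) measurable_const
    simpa using this.symm
  refine Measure.ext_of_lintegral _ fun f hf => ?_
  rw [h2 f hf, hc, one_mul]

end

section

/-- abstract Hecke map -/
def sH {m : ℕ} {ι : Type*} (c : ι → SLR m) (h : SLR m) (i : ι) : Xspace m :=
  QuotientGroup.mk (h * c i)

lemma sH_eq {m : ℕ} {ι : Type*} {c : ι → SLR m}
    (hc : ∀ γ ∈ SLZ m, ∃ π : Equiv.Perm ι, ∀ i,
      (QuotientGroup.mk (γ * c i) : Xspace m) = QuotientGroup.mk (c (π i))) : Equivar (sH c) := by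
  intro h γ hγ
  obtain ⟨π, hπ⟩ := hc γ hγ
  refine ⟨π, fun i => ?_⟩
  have : h • (QuotientGroup.mk (γ * c i) : Xspace m) = h • (QuotientGroup.mk (c (π i)) : Xspace m) := by
    rw [hπ]
  simpa [sH, mul_assoc] using! this

theorem hecke_avg {m : ℕ} {ι : Type*} [Fintype ι] [Nonempty ι] {c : ι → SLR m}
    (hc : ∀ γ ∈ SLZ m, ∃ π : Equiv.Perm ι, ∀ i,
      (QuotientGroup.mk (γ * c i) : Xspace m) = QuotientGroup.mk (c (π i)))
    (μ : Measure (Xspace m)) [IsProbabilityMeasure μ] (hμ : InvM μ)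
    {f : Xspace m → ENNReal} (hf : Measurable f) :
    ∫⁻ x, Av (sH c) f x ∂μ = Fintype.card ι * ∫⁻ x, f x ∂μ := by
  have hs := sH_eq hc
  have hm : ∀ i, Measurable fun h => sH c h i := fun i => meas_mk.comp (measurable_mul_const (c i))
  have hN : (Fintype.card ι : ENNReal) ≠ 0 := by simp
  have hN' : (Fintype.card ι : ENNReal) ≠ ⊤ := by simp
  let ν : Measure (Xspace m) := (Fintype.card ι : ENNReal)⁻¹ • μ.bind (qker (sH c))
  have h1 : IsProbabilityMeasure ν := by
    constructor
    have : μ.bind (qker (sH c)) Set.univ = Fintype.card ι := by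
      rw [← lintegral_one, bind_lint hs hm μ (F := fun _ => 1) measurable_const]
      simp [Av, tsum_fintype]
    simp [ν, this, ENNReal.inv_mul_cancel hN hN']
  have h2 : InvM ν := by
    intro γ
    simp only [ν, Measure.map_smul]
    rw [bind_inv hs hm hμ γ (fun x => γ • x) (meas_smulX γ)]
    intro h i
    simp [sH, mul_assoc]
  have h3 := invX_unique μ ν hμ h2
  have h4 : ∫⁻ x, f x ∂μ = ∫⁻ x, f x ∂ν := by rw [← h3]
  rw [h4]
  simp only [ν, lintegral_smul_measure, smul_eq_mul]
  rw [bind_lint hs hm μ hf, ← mul_assoc, ENNReal.mul_inv_cancel hN hN', one_mul]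

lemma exists_beta {m p : ℕ} [hp : Fact p.Prime] (a : Fin m → ZMod p) (ha : a ≠ 0) :
    ∃ B : Matrix (Fin m) (Fin m) ℤ, B.det = p ∧
      ∀ x : Fin m → ℤ, (∃ y, B.mulVec y = x) ↔ ∑ i, a i * (x i : ZMod p) = 0 := by
  obtain ⟨j, hj⟩ : ∃ j, a j ≠ 0 := by
    by_contra! h
    exact ha (funext h)
  have ht : ∀ i, ∃ t : ℤ, (t : ZMod p) = a i / a j := fun i => ZMod.intCast_surjective _
  choose t ht using ht
  let u : Fin m → ℤ := fun i => if i = j then 0 else t i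
  let B : Matrix (Fin m) (Fin m) ℤ := (1 : Matrix (Fin m) (Fin m) ℤ).updateRow j
    (fun i => (if i = j then (p : ℤ) else 0) - u i)
  have hB : ∀ y i, B.mulVec y i = if i = j then p * y j - ∑ i, u i * y i else y i := by
    intro y i
    split_ifs with h
    · subst h
      simp [B, Matrix.mulVec, dotProduct, sub_mul, Finset.sum_sub_distrib]
    · simp [B, Matrix.mulVec, dotProduct, h, Matrix.one_apply]
  refine ⟨B, ?_, fun x => ?_⟩
  · have : B = (((1 : Matrix (Fin m) (Fin m) ℤ).updateCol j
      (fun i => (if i = j then (p : ℤ) else 0) - u i)))ᵀ := by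
      ext i l
      simp only [B, Matrix.transpose_apply, Matrix.updateRow_apply, Matrix.updateCol_apply,
        Matrix.one_apply, eq_comm]
    rw [this, Matrix.det_transpose, ← Matrix.cramer_apply, Matrix.cramer_one]
    simp [u]
  · have hu : ∑ i, a i * (x i : ZMod p) = a j * (x j + ∑ i, u i * x i : ℤ) := by
      push_cast
      rw [mul_add, Finset.mul_sum, ← Finset.add_sum_erase _ _ (Finset.mem_univ j)]
      congr 1
      rw [← Finset.add_sum_erase _ (fun i => a j * ((u i : ZMod p) * (x i : ZMod p))) (Finset.mem_univ j)]
      simp only [u, if_true, Int.cast_zero, zero_mul, mul_zero, zero_add]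
      refine Finset.sum_congr rfl fun i hi => ?_
      rw [if_neg (Finset.ne_of_mem_erase hi), ht]
      field_simp
    rw [hu, mul_eq_zero, or_iff_right hj, ZMod.intCast_zmod_eq_zero_iff_dvd]
    constructor
    · rintro ⟨y, rfl⟩
      have h1 : ∑ i, u i * B.mulVec y i = ∑ i, u i * y i := by
        refine Finset.sum_congr rfl fun i _ => ?_
        rw [hB]
        split_ifs with h
        · simp [u, h]
        · rfl
      rw [h1, hB]
      simp
    · rintro ⟨q, hq⟩
      refine ⟨Function.update x j q, funext fun i => ?_⟩
      have h1 : ∑ i, u i * Function.update x j q i = ∑ i, u i * x i := by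
        refine Finset.sum_congr rfl fun i _ => ?_
        by_cases h : i = j
        · simp [u, h]
        · simp [h]
      rw [hB, h1]
      split_ifs with h
      · subst h
        simp
        linarith
      · simp [h]

def betaM {m p : ℕ} [Fact p.Prime] (a : {a : Fin m → ZMod p // a ≠ 0}) : Matrix (Fin m) (Fin m) ℤ :=
  (exists_beta a.1 a.2).choose

lemma betaM_det {m p : ℕ} [Fact p.Prime] (a : {a : Fin m → ZMod p // a ≠ 0}) :
    (betaM a).det = p := (exists_beta a.1 a.2).choose_spec.1

lemma betaM_range {m p : ℕ} [Fact p.Prime] (a : {a : Fin m → ZMod p // a ≠ 0}) (x : Fin m → ℤ) :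
    (∃ y, (betaM a).mulVec y = x) ↔ ∑ i, a.1 i * (x i : ZMod p) = 0 :=
  (exists_beta a.1 a.2).choose_spec.2 x

/-- the scale p^{1/m} -/
def scl (m p : ℕ) : ℝ := (p : ℝ) ^ ((m : ℝ)⁻¹)

lemma pos_of_idx {m p : ℕ} (a : {a : Fin m → ZMod p // a ≠ 0}) : m ≠ 0 := by
  rintro rfl
  exact a.2 (Subsingleton.elim _ _)

lemma scl_pow {m p : ℕ} (hm : m ≠ 0) : scl m p ^ m = p := by
  rw [scl, Real.rpow_inv_natCast_pow (by positivity) hm]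

lemma scl_pos {m p : ℕ} [hp : Fact p.Prime] : 0 < scl m p :=
  Real.rpow_pos_of_pos (by exact_mod_cast hp.1.pos) _

def cM {m p : ℕ} [hp : Fact p.Prime] (a : {a : Fin m → ZMod p // a ≠ 0}) : SLR m :=
  ⟨(scl m p)⁻¹ • (betaM a).map (Int.cast : ℤ → ℝ), by
    have h0 : (p : ℝ) ≠ 0 := by exact_mod_cast hp.1.ne_zero
    have := betaM_det a
    have h1 : ((betaM a).map (Int.cast : ℤ → ℝ)).det = p := by
      have := congrArg (Int.cast : ℤ → ℝ) this
      rw [Int.cast_det] at this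
      simpa using this
    rw [Matrix.det_smul, h1, Fintype.card_fin, inv_pow, scl_pow (pos_of_idx a)]
    field_simp⟩

lemma cM_coe {m p : ℕ} [hp : Fact p.Prime] (a : {a : Fin m → ZMod p // a ≠ 0}) :
    (cM a : Matrix (Fin m) (Fin m) ℝ) = (scl m p)⁻¹ • (betaM a).map (Int.cast : ℤ → ℝ) := rfl

lemma cM_perm {m p : ℕ} [hp : Fact p.Prime] (γ : SLR m) (hγ : γ ∈ SLZ m) :
    ∃ π : Equiv.Perm {a : Fin m → ZMod p // a ≠ 0}, ∀ i,
      (QuotientGroup.mk (γ * cM i) : Xspace m) = QuotientGroup.mk (cM (π i)) := by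
  obtain ⟨δ, rfl⟩ := hγ
  let D : Matrix (Fin m) (Fin m) (ZMod p) := (δ : Matrix (Fin m) (Fin m) ℤ).map (Int.cast)
  let D' : Matrix (Fin m) (Fin m) (ZMod p) := ((δ⁻¹ : Matrix.SpecialLinearGroup (Fin m) ℤ) : Matrix (Fin m) (Fin m) ℤ).map (Int.cast)
  have e1 : D * D' = 1 := by
    have : ((δ * δ⁻¹ : Matrix.SpecialLinearGroup (Fin m) ℤ) : Matrix (Fin m) (Fin m) ℤ) = 1 := by
      rw [mul_inv_cancel]; rfl
    rw [Matrix.SpecialLinearGroup.coe_mul] at this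
    have h2 := congrArg (fun M => Matrix.map M (Int.castRingHom (ZMod p))) this
    simp only [Matrix.map_mul] at h2
    rw [Matrix.map_one _ (by simp) (by simp)] at h2
    exact h2
  have e2 : D' * D = 1 := by
    exact mul_eq_one_comm.1 e1
  let π : Equiv.Perm {a : Fin m → ZMod p // a ≠ 0} :=
    { toFun := fun a => ⟨a.1 ᵥ* D', fun h => a.2 (by
        have := congrArg (fun v => v ᵥ* D) h
        simpa [Matrix.vecMul_vecMul, e2] using this)⟩
      invFun := fun a => ⟨a.1 ᵥ* D, fun h => a.2 (by
        have := congrArg (fun v => v ᵥ* D') h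
        simpa [Matrix.vecMul_vecMul, e1] using this)⟩
      left_inv := fun a => by simp [Matrix.vecMul_vecMul, e2]
      right_inv := fun a => by simp [Matrix.vecMul_vecMul, e1] }
  refine ⟨π, fun a => ?_⟩
  have hcol : ∀ y : Fin m → ℤ, ∃ z, (betaM (π a)).mulVec z
      = ((δ : Matrix (Fin m) (Fin m) ℤ) * betaM a).mulVec y := by
    intro y
    rw [betaM_range]
    have h1 := (betaM_range a _).1 ⟨y, rfl⟩
    have h2 : (fun i => ((((δ : Matrix (Fin m) (Fin m) ℤ) * betaM a).mulVec y i : ℤ) : ZMod p)) =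
      D.mulVec (fun i => (((betaM a).mulVec y i : ℤ) : ZMod p)) := by
      rw [← Matrix.mulVec_mulVec]
      ext i
      simp [D, Matrix.mulVec, dotProduct]
    have h3 : (a.1 ᵥ* D') ⬝ᵥ (fun i => ((((δ : Matrix (Fin m) (Fin m) ℤ) * betaM a).mulVec y i : ℤ) : ZMod p)) = 0 := by
      rw [h2, Matrix.dotProduct_mulVec, Matrix.vecMul_vecMul, e2, Matrix.vecMul_one]
      exact h1
    exact h3
  choose z hz using fun j => hcol (Pi.single j 1)
  let Z : Matrix (Fin m) (Fin m) ℤ := Matrix.of fun i j => z j i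
  have hZ : betaM (π a) * Z = (δ : Matrix (Fin m) (Fin m) ℤ) * betaM a := by
    ext i j
    have := congrFun (hz j) i
    rw [Matrix.mulVec_single_one] at this
    exact this
  have hdet : Z.det = 1 := by
    have := congrArg Matrix.det hZ
    rw [Matrix.det_mul, Matrix.det_mul, betaM_det, betaM_det] at this
    simp only [Matrix.SpecialLinearGroup.det_coe, one_mul] at this
    have h0 : (p : ℤ) ≠ 0 := by exact_mod_cast hp.1.ne_zero
    exact mul_left_cancel₀ h0 (by rw [this, mul_one])
  rw [eq_comm, QuotientGroup.eq]
  refine ⟨⟨Z, hdet⟩, ?_⟩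
  rw [eq_inv_mul_iff_mul_eq]
  apply Subtype.ext
  rw [Matrix.SpecialLinearGroup.coe_mul, Matrix.SpecialLinearGroup.coe_mul, cM_coe, cM_coe]
  have h5 := congrArg (fun M => Matrix.map M (Int.castRingHom ℝ)) hZ
  simp only [Matrix.map_mul] at h5
  rw [Matrix.smul_mul, Matrix.mul_smul]
  congr 1

/-- the Siegel map -/
def sT {m : ℕ} (r : ℕ) (h : SLR m) (v : Fin r → Fin m → ℤ) : Fin r → Fin m → ℝ :=
  fun i => (h : Matrix (Fin m) (Fin m) ℝ).mulVec (fun j => ((v i j : ℤ) : ℝ))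

lemma sT_eq {m : ℕ} (r : ℕ) : Equivar (sT (m := m) r) := by
  rintro h γ ⟨δ, rfl⟩
  let π : Equiv.Perm (Fin r → Fin m → ℤ) :=
    { toFun := fun v i => (δ : Matrix (Fin m) (Fin m) ℤ).mulVec (v i)
      invFun := fun v i =>
        ((δ⁻¹ : Matrix.SpecialLinearGroup (Fin m) ℤ) : Matrix (Fin m) (Fin m) ℤ).mulVec (v i)
      left_inv := fun v => by
        ext i j
        change ((δ⁻¹ : Matrix.SpecialLinearGroup (Fin m) ℤ) : Matrix (Fin m) (Fin m) ℤ).mulVec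
          ((δ : Matrix (Fin m) (Fin m) ℤ).mulVec (v i)) j = v i j
        rw [Matrix.mulVec_mulVec, ← Matrix.SpecialLinearGroup.coe_mul, inv_mul_cancel]
        simp
      right_inv := fun v => by
        ext i j
        change (δ : Matrix (Fin m) (Fin m) ℤ).mulVec
          (((δ⁻¹ : Matrix.SpecialLinearGroup (Fin m) ℤ) : Matrix (Fin m) (Fin m) ℤ).mulVec (v i)) j = v i j
        rw [Matrix.mulVec_mulVec, ← Matrix.SpecialLinearGroup.coe_mul, mul_inv_cancel]
        simp }
  refine ⟨π, fun v => funext fun i => ?_⟩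
  simp only [sT, Matrix.SpecialLinearGroup.coe_mul, ← Matrix.mulVec_mulVec]
  congr 1
  ext j
  simp [π, Matrix.mulVec, dotProduct]

lemma sT_meas {m r : ℕ} (v : Fin r → Fin m → ℤ) : Measurable fun h : SLR m => sT r h v := by
  refine measurable_pi_iff.2 fun i => measurable_pi_iff.2 fun j => ?_
  simp only [sT, Matrix.mulVec, dotProduct]
  exact Finset.measurable_sum _ fun k _ => (meas_entry j k).mul_const _

open Classical in
lemma hecke_count {m p r : ℕ} [hp : Fact p.Prime] (F : (Fin r → Fin m → ℝ) → ENNReal) (h : SLR m) :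
    Av (sH (cM (m := m) (p := p))) (Av (sT r) F) (QuotientGroup.mk h) =
      ∑' w : Fin r → Fin m → ℤ, (Fintype.card {a : {a : Fin m → ZMod p // a ≠ 0} //
        ∀ i, ∑ j, a.1 j * (w i j : ZMod p) = 0} : ENNReal) * F ((scl m p)⁻¹ • sT r h w) := by
  rw [Av_mk (sH_eq cM_perm), tsum_fintype]
  have h1 : ∀ a : {a : Fin m → ZMod p // a ≠ 0}, Av (sT r) F (sH cM h a) =
      ∑' w : Fin r → Fin m → ℤ, if ∀ i, ∑ j, a.1 j * (w i j : ZMod p) = 0 then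
        F ((scl m p)⁻¹ • sT r h w) else 0 := by
    intro a
    rw [sH, Av_mk (sT_eq r)]
    let φ : (Fin r → Fin m → ℤ) → (Fin r → Fin m → ℤ) := fun v i => (betaM a).mulVec (v i)
    have hφ : Function.Injective φ := by
      intro v v' hv
      ext i j
      have h2 := congrFun hv i
      have h3 : (betaM a).det ≠ 0 := by rw [betaM_det]; exact_mod_cast hp.1.ne_zero
      have h4 := Matrix.eq_zero_of_mulVec_eq_zero h3 (v := v i - v' i) (by
        rw [Matrix.mulVec_sub, sub_eq_zero]; exact h2)
      exact congrFun (sub_eq_zero.1 h4) j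
    refine Eq.trans ?_ (hφ.tsum_eq (f := fun w : Fin r → Fin m → ℤ =>
      if ∀ i, ∑ j, a.1 j * (w i j : ZMod p) = 0 then F ((scl m p)⁻¹ • sT r h w) else 0) ?_)
    · refine tsum_congr fun v => ?_
      rw [if_pos (fun i => (betaM_range a _).1 ⟨v i, rfl⟩)]
      congr 1
      ext i j
      simp only [sT, Matrix.SpecialLinearGroup.coe_mul, ← Matrix.mulVec_mulVec, cM_coe,
        Matrix.smul_mulVec, Matrix.mulVec_smul, Pi.smul_apply, φ]
      congr 2
      ext l
      simp [Matrix.mulVec, dotProduct]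
    · intro w hw
      simp only [Function.mem_support, ne_eq, ite_eq_right_iff, Classical.not_imp] at hw
      choose y hy using fun i => (betaM_range a (w i)).2 (hw.1 i)
      exact ⟨y, funext hy⟩
  simp_rw [h1]
  rw [← Summable.tsum_finsetSum (fun _ _ => ENNReal.summable)]
  refine tsum_congr fun w => ?_
  rw [Finset.sum_ite, Finset.sum_const_zero, add_zero, Finset.sum_const, nsmul_eq_mul,
    Fintype.card_subtype]

end

section

open Filter Topology Pointwise Bornology

lemma mp_uncurry (r m : ℕ) : MeasurePreserving
    (fun (x : Fin r → Fin m → ℝ) (q : Fin r × Fin m) => x q.1 q.2) volume volume := by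
  have hm : Measurable (fun (x : Fin r → Fin m → ℝ) (q : Fin r × Fin m) => x q.1 q.2) := by
    fun_prop
  refine ⟨hm, ?_⟩
  symm
  refine Measure.pi_eq fun s hs => ?_
  rw [Measure.map_apply hm (MeasurableSet.univ_pi hs)]
  have : (fun (x : Fin r → Fin m → ℝ) (q : Fin r × Fin m) => x q.1 q.2) ⁻¹' (Set.univ.pi s) =
      Set.univ.pi fun i => Set.univ.pi fun j => s (i, j) := by
    ext x; simp [Set.mem_pi]
  rw [this, volume_pi_pi, Fintype.prod_prod_type]
  simp_rw [volume_pi_pi]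

def castV {r m : ℕ} (w : Fin r → Fin m → ℤ) : Fin r → Fin m → ℝ := fun i j => (w i j : ℝ)

def uncL (r m : ℕ) : (Fin r → Fin m → ℝ) ≃L[ℝ] (Fin r × Fin m → ℝ) :=
  ((LinearEquiv.curry ℝ ℝ (Fin r) (Fin m)).symm).toContinuousLinearEquiv

lemma uncL_apply {r m : ℕ} (x : Fin r → Fin m → ℝ) (q) : uncL r m x q = x q.1 q.2 := rfl

lemma count_lim {r m : ℕ} {S : Set (Fin r → Fin m → ℝ)} (hb : IsBounded S) (hm : MeasurableSet S)
    (hf : volume (frontier S) = 0) (hs : ∀ ⦃x y : ℝ⦄, 0 < x → x ≤ y → x • S ⊆ y • S) :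
    Tendsto (fun x : ℝ => (Nat.card {w : Fin r → Fin m → ℤ | x⁻¹ • castV w ∈ S} : ℝ) / x ^ (r * m))
      atTop (𝓝 (volume.real S)) := by
  have hmp : MeasurePreserving (uncL r m) volume volume := mp_uncurry r m
  have hpre : ∀ A : Set (Fin r → Fin m → ℝ), volume (uncL r m '' A) = volume A := by
    intro A
    rw [← hmp.measure_preimage_equiv (f := (uncL r m).toHomeomorph.toMeasurableEquiv)]
    congr 1
    exact (Set.preimage_image_eq A (uncL r m).injective)
  have key := tendsto_card_div_pow_atTop_volume' (uncL r m '' S) ?_ ?_ ?_ ?_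
  · have e : volume.real (uncL r m '' S) = volume.real S := by simp [measureReal_def, hpre]
    rw [e] at key
    refine key.congr' ?_
    filter_upwards [eventually_gt_atTop 0] with x hx
    simp only [Fintype.card_prod, Fintype.card_fin]
    congr 2
    symm
    refine Nat.card_congr (Equiv.ofBijective (fun w => ⟨uncL r m (x⁻¹ • castV w.1), ⟨_, w.2, rfl⟩, ?_⟩) ⟨?_, ?_⟩)
    · refine ⟨uncL r m (castV w.1), ?_, by simp⟩
      rw [SetLike.mem_coe, Module.Basis.mem_span_iff_repr_mem]
      intro q
      exact ⟨w.1 q.1 q.2, by simp [castV, uncL_apply]⟩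
    · intro w w' h
      have h1 := (uncL r m).injective (congrArg Subtype.val h)
      have h2 := smul_right_injective (Fin r → Fin m → ℝ) (inv_ne_zero hx.ne') h1
      apply Subtype.ext
      ext i j
      have := congrFun (congrFun h2 i) j
      simpa [castV] using this
    · rintro ⟨_, ⟨s, hsS, rfl⟩, ⟨l, hl, hl2⟩⟩
      rw [SetLike.mem_coe, Module.Basis.mem_span_iff_repr_mem] at hl
      choose c hc using hl
      have : s = x⁻¹ • castV (fun i j => c (i, j)) := by
        apply (uncL r m).injective
        rw [← hl2]
        ext q
        have := hc q
        simp at this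
        simp [uncL_apply, castV, this]
      exact ⟨⟨fun i j => c (i,j), by rw [Set.mem_ofPred_eq, ← this]; exact hsS⟩, by simp [← this]⟩
  · exact ((uncL r m).lipschitz.isBounded_image hb)
  · exact (uncL r m).toHomeomorph.toMeasurableEquiv.measurableSet_image.2 hm
  · have : frontier (uncL r m '' S) = uncL r m '' frontier S :=
      ((uncL r m).toHomeomorph.image_frontier S).symm
    rw [this, hpre, hf]
  · intro x y hx hxy
    have : ∀ c : ℝ, c • (uncL r m '' S) = uncL r m '' (c • S) := fun c => by
      rw [image_smul_set]
    rw [this, this]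
    exact Set.image_mono (hs hx hxy)

def Ind (r m : ℕ) : Set (Fin r → Fin m → ℝ) := {v | LinearIndependent ℝ v}

lemma Ind_open (r m : ℕ) : IsOpen (Ind r m) := isOpen_setOfPred_linearIndependent

lemma Ind_null {r m : ℕ} (h : r ≤ m) : volume (Ind r m)ᶜ = 0 := by
  induction r with
  | zero =>
    have : (Ind 0 m)ᶜ = ∅ := by
      rw [Set.compl_empty_iff]
      ext v
      simp only [Ind, Set.mem_ofPred_eq, Set.mem_univ, iff_true]
      exact linearIndependent_empty_type
    simp [this]
  | succ r ih =>
    have hmp := volume_preserving_piFinSuccAbove (fun _ : Fin (r+1) => Fin m → ℝ) 0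
    let e := MeasurableEquiv.piFinSuccAbove (fun _ : Fin (r+1) => Fin m → ℝ) 0
    have hsm : MeasurableSet (Ind (r+1) m)ᶜ := (Ind_open _ _).measurableSet.compl
    rw [← (hmp.symm e).measure_preimage_equiv]
    change (Measure.prod volume volume) _ = 0
    have hs2 : MeasurableSet ((e.symm) ⁻¹' (Ind (r+1) m)ᶜ) := e.symm.measurable hsm
    rw [Measure.prod_apply_symm hs2]
    have h0 : ∀ᵐ y ∂(volume : Measure (Fin r → Fin m → ℝ)), y ∈ Ind r m := by
      rw [ae_iff]; exact ih (by omega)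
    rw [lintegral_congr_ae (g := fun _ => 0), lintegral_zero]
    filter_upwards [h0] with y hy
    have hne : Submodule.span ℝ (Set.range y) ≠ ⊤ := by
      intro htop
      have h1 := finrank_range_le_card (R := ℝ) y
      rw [Set.finrank, htop, finrank_top] at h1
      simp at h1
      omega
    refine measure_mono_null ?_ (Measure.addHaar_submodule volume _ hne)
    intro x hx
    by_contra hxs
    apply hx
    change LinearIndependent ℝ (e.symm (x, y))
    have : e.symm (x, y) = Fin.cons x y := by
      ext i j
      simp [e, MeasurableEquiv.piFinSuccAbove]
    rw [this]
    exact linearIndependent_finCons.2 ⟨hy, hxs⟩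

end

section

open Filter Topology Pointwise Bornology

lemma exists_minor {K : Type*} [Field K] {r m : ℕ} {W : Fin r → Fin m → K}
    (hW : LinearIndependent K W) : ∃ σ : Fin r → Fin m, ((Matrix.of W).submatrix id σ).det ≠ 0 := by
  have h1 : (Matrix.of W).rank = r := by
    have := LinearIndependent.rank_matrix (M := Matrix.of W) hW
    simpa using this
  rw [Matrix.rank_eq_finrank_span_cols] at h1
  have hex := Submodule.exists_fun_fin_finrank_span_eq K (Set.range (Matrix.of W).col)
  rw [h1] at hex
  obtain ⟨f, hf, -, hi⟩ := hex
  choose σ hσ using hf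
  refine ⟨σ, ?_⟩
  rw [← isUnit_iff_ne_zero, ← Matrix.isUnit_iff_isUnit_det, ← Matrix.linearIndependent_cols_iff_isUnit]
  have e : ((Matrix.of W).submatrix id σ).col = f := by
    ext i j
    rw [← hσ]
    rfl
  rw [e]
  exact hi

lemma indep_of_minor {K : Type*} [Field K] {r m : ℕ} {W : Fin r → Fin m → K} (σ : Fin r → Fin m)
    (h : ((Matrix.of W).submatrix id σ).det ≠ 0) : LinearIndependent K W := by
  rw [← isUnit_iff_ne_zero, ← Matrix.isUnit_iff_isUnit_det, ← Matrix.linearIndependent_rows_iff_isUnit] at h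
  exact LinearIndependent.of_comp (LinearMap.funLeft K K σ) h

lemma indep_mod {r m p : ℕ} [hp : Fact p.Prime] (w : Fin r → Fin m → ℤ) {M : ℝ}
    (hw : castV w ∈ Ind r m) (hM : ∀ i j, |(w i j : ℝ)| ≤ M) (hp2 : (r.factorial : ℝ) * M ^ r < p) :
    LinearIndependent (ZMod p) (fun i j => (w i j : ZMod p)) := by
  obtain ⟨σ, hσ⟩ := exists_minor hw
  refine indep_of_minor σ ?_
  let N : Matrix (Fin r) (Fin r) ℤ := (Matrix.of w).submatrix id σ
  have e1 : ((Matrix.of (castV w)).submatrix id σ).det = (N.det : ℝ) := by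
    rw [Int.cast_det]; rfl
  have e2 : ((Matrix.of (fun i j => (w i j : ZMod p))).submatrix id σ).det = (N.det : ZMod p) := by
    rw [Int.cast_det]; rfl
  rw [e1] at hσ
  rw [e2]
  intro h
  rw [ZMod.intCast_zmod_eq_zero_iff_dvd] at h
  have h0 : N.det ≠ 0 := by exact_mod_cast hσ
  have h1 := Int.le_of_dvd (abs_pos.2 h0) ((dvd_abs _ _).2 h)
  have h2 : |((Matrix.of (castV w)).submatrix id σ).det| ≤ r.factorial * M ^ r := by
    have := Matrix.det_le (A := (Matrix.of (castV w)).submatrix id σ) (abv := AbsoluteValue.abs) (x := M)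
      (fun i j => hM _ _)
    simpa using this
  rw [e1] at h2
  have h3 : (p : ℝ) ≤ |(N.det : ℝ)| := by exact_mod_cast h1
  linarith

open Classical in
lemma card_mod {r m p : ℕ} [hp : Fact p.Prime] (w : Fin r → Fin m → ZMod p)
    (hw : LinearIndependent (ZMod p) w) :
    Fintype.card {a : {a : Fin m → ZMod p // a ≠ 0} // ∀ i, ∑ j, a.1 j * w i j = 0} + 1
      = p ^ (m - r) := by
  let W : Matrix (Fin r) (Fin m) (ZMod p) := Matrix.of w
  have h1 : W.rank = r := by
    have := LinearIndependent.rank_matrix (M := W) hw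
    simpa using this
  have h2 := LinearMap.finrank_range_add_finrank_ker W.mulVecLin
  rw [← Matrix.rank, h1] at h2
  simp at h2
  have h3 := Module.card_eq_pow_finrank (K := ZMod p) (V := LinearMap.ker W.mulVecLin)
  rw [ZMod.card] at h3
  have h4 : Module.finrank (ZMod p) (LinearMap.ker W.mulVecLin) = m - r := by omega
  rw [h4] at h3
  rw [← h3, ← Fintype.card_option]
  refine Fintype.card_congr ?_
  have hmem : ∀ a : Fin m → ZMod p, a ∈ LinearMap.ker W.mulVecLin ↔ ∀ i, ∑ j, a j * w i j = 0 := by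
    intro a
    rw [LinearMap.mem_ker, Matrix.mulVecLin_apply, funext_iff]
    refine forall_congr' fun i => ?_
    simp [W, Matrix.mulVec, dotProduct, mul_comm]
  refine Equiv.ofBijective (fun o => match o with
    | none => 0
    | some a => ⟨a.1.1, (hmem _).2 a.2⟩) ⟨?_, ?_⟩
  · rintro (_ | ⟨⟨a, ha⟩, ha2⟩) (_ | ⟨⟨b, hb⟩, hb2⟩) hab
    · rfl
    · exact absurd (congrArg Subtype.val hab).symm hb
    · exact absurd (congrArg Subtype.val hab) ha
    · have := congrArg Subtype.val hab
      simp at this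
      simp [this]
  · rintro ⟨a, ha⟩
    by_cases h : a = 0
    · exact ⟨none, by subst h; rfl⟩
    · exact ⟨some ⟨⟨a, h⟩, (hmem a).1 ha⟩, rfl⟩

def actH {m r : ℕ} (h : SLR m) (x : Fin r → Fin m → ℝ) : Fin r → Fin m → ℝ :=
  fun i => (h : Matrix (Fin m) (Fin m) ℝ).mulVec (x i)

lemma sT_actH {m r : ℕ} (h : SLR m) (w : Fin r → Fin m → ℤ) : sT r h w = actH h (castV w) := rfl

lemma mp_actH {m r : ℕ} (h : SLR m) : MeasurePreserving (actH (r := r) h) volume volume := by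
  have h1 : MeasurePreserving (fun v : Fin m → ℝ => (h : Matrix (Fin m) (Fin m) ℝ).mulVec v) volume volume := by
    refine ⟨by fun_prop, ?_⟩
    have := Real.map_matrix_volume_pi_eq_smul_volume_pi (M := (h : Matrix (Fin m) (Fin m) ℝ)) (by simp)
    simpa using! this
  exact volume_preserving_pi (fun _ => h1)

lemma actH_smul {m r : ℕ} (h : SLR m) (c : ℝ) (x : Fin r → Fin m → ℝ) :
    actH h (c • x) = c • actH h x := by
  ext i j
  simp [actH, Matrix.mulVec_smul]

lemma actH_inv {m r : ℕ} (h : SLR m) (x : Fin r → Fin m → ℝ) : actH h⁻¹ (actH h x) = x := by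
  ext i j
  simp only [actH, Matrix.mulVec_mulVec, ← Matrix.SpecialLinearGroup.coe_mul, inv_mul_cancel]
  simp

lemma actH_Ind {m r : ℕ} (h : SLR m) {x : Fin r → Fin m → ℝ} (hx : x ∈ Ind r m) :
    actH h x ∈ Ind r m := by
  refine LinearIndependent.map' hx (h : Matrix (Fin m) (Fin m) ℝ).mulVecLin ?_
  rw [LinearMap.ker_eq_bot]
  intro v w hvw
  have := congrArg (fun v => ((h⁻¹ : SLR m) : Matrix (Fin m) (Fin m) ℝ).mulVec v) hvw
  simp only [Matrix.mulVecLin_apply, Matrix.mulVec_mulVec, ← Matrix.SpecialLinearGroup.coe_mul, inv_mul_cancel] at this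
  simpa using this

lemma actH_Ind_iff {m r : ℕ} (h : SLR m) {x : Fin r → Fin m → ℝ} :
    actH h x ∈ Ind r m ↔ x ∈ Ind r m :=
  ⟨fun hx => by simpa [actH_inv] using actH_Ind h⁻¹ hx, actH_Ind h⟩

lemma smul_Ind {m r : ℕ} {c : ℝ} (hc : c ≠ 0) {x : Fin r → Fin m → ℝ} (hx : x ∈ Ind r m) :
    c • x ∈ Ind r m :=
  LinearIndependent.map' hx (LinearMap.lsmul ℝ _ c) (by
    rw [LinearMap.ker_eq_bot]
    exact smul_right_injective _ hc)

lemma smul_Ind_iff {m r : ℕ} {c : ℝ} (hc : c ≠ 0) {x : Fin r → Fin m → ℝ} :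
    c • x ∈ Ind r m ↔ x ∈ Ind r m :=
  ⟨fun h => by simpa [smul_smul, inv_mul_cancel₀ hc] using smul_Ind (inv_ne_zero hc) h, smul_Ind hc⟩

lemma actH_cont {m r : ℕ} (h : SLR m) : Continuous (actH (r := r) h) := by
  unfold actH
  refine continuous_pi fun i => ?_
  exact Continuous.matrix_mulVec continuous_const (continuous_apply i)

end

section

open Filter Topology Pointwise Bornology

lemma finite_bdd {r m : ℕ} (K : ℝ) : {w : Fin r → Fin m → ℤ | ∀ i j, |(w i j : ℝ)| ≤ K}.Finite := by
  refine (Set.finite_Icc (fun _ _ => -⌊K⌋ : Fin r → Fin m → ℤ) (fun _ _ => ⌊K⌋)).subset ?_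
  intro w hw
  have h1 : ∀ i j, |w i j| ≤ ⌊K⌋ := fun i j => by
    rw [Int.le_floor]; push_cast; exact hw i j
  exact ⟨fun i j => (abs_le.1 (h1 i j)).1, fun i j => (abs_le.1 (h1 i j)).2⟩

def iF {r m : ℕ} (A : Set (Fin r → Fin m → ℝ)) : (Fin r → Fin m → ℝ) → ENNReal :=
  (A ∩ Ind r m).indicator 1

lemma hecke_val {m p r : ℕ} [hp : Fact p.Prime] {A : Set (Fin r → Fin m → ℝ)} (h : SLR m) {C : ℝ}
    (hC : ∀ x, actH h x ∈ A → ∀ i j, |x i j| ≤ C)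
    (hp2 : (r.factorial : ℝ) * (C * scl m p) ^ r < p) :
    Av (sH (cM (m := m) (p := p))) (Av (sT r) (iF A)) (QuotientGroup.mk h) =
      ((p ^ (m - r) - 1 : ℕ) : ENNReal) *
        (Nat.card {w : Fin r → Fin m → ℤ | (scl m p)⁻¹ • castV w ∈ {x | actH h x ∈ A ∩ Ind r m}} : ENNReal) := by
  classical
  rw [hecke_count]
  set W : Set (Fin r → Fin m → ℤ) :=
    {w : Fin r → Fin m → ℤ | (scl m p)⁻¹ • castV w ∈ {x | actH h x ∈ A ∩ Ind r m}} with hW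
  have hs := scl_pos (m := m) (p := p)
  have hbd : ∀ w ∈ W, ∀ i j, |(w i j : ℝ)| ≤ C * scl m p := by
    intro w hw i j
    have h1 := hC _ hw.1 i j
    simp only [Pi.smul_apply, castV, smul_eq_mul, abs_mul, abs_inv, abs_of_pos hs] at h1
    rw [inv_mul_le_iff₀ hs] at h1
    linarith
  have hfin : W.Finite := (finite_bdd (C * scl m p)).subset hbd
  have h2 : ∀ w : Fin r → Fin m → ℤ, (Fintype.card {a : {a : Fin m → ZMod p // a ≠ 0} //
        ∀ i, ∑ j, a.1 j * (w i j : ZMod p) = 0} : ENNReal) * iF A ((scl m p)⁻¹ • sT r h w)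
      = ((p ^ (m - r) - 1 : ℕ) : ENNReal) * W.indicator 1 w := by
    intro w
    by_cases hw : w ∈ W
    · have hi : castV w ∈ Ind r m := by
        have := hw.2
        rw [actH_Ind_iff, smul_Ind_iff (inv_ne_zero hs.ne')] at this
        exact this
      have h3 := card_mod _ (indep_mod w hi (hbd w hw) hp2)
      have h4 : (scl m p)⁻¹ • sT r h w ∈ A ∩ Ind r m := by
        rw [sT_actH, ← actH_smul]; exact hw
      rw [iF, Set.indicator_of_mem h4, Set.indicator_of_mem hw]
      congr 2
      omega
    · have h4 : (scl m p)⁻¹ • sT r h w ∉ A ∩ Ind r m := by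
        rw [sT_actH, ← actH_smul]; exact hw
      rw [iF, Set.indicator_of_notMem h4, Set.indicator_of_notMem hw, mul_zero, mul_zero]
  simp_rw [h2]
  rw [ENNReal.tsum_mul_left]
  congr 1
  rw [← tsum_subtype W (1 : (Fin r → Fin m → ℤ) → ENNReal)]
  simp only [Pi.one_apply]
  rw [ENNReal.tsum_set_one, ← hfin.cast_ncard_eq]
  rfl

lemma card_idx {m p : ℕ} [hp : Fact p.Prime] :
    Nat.card {a : Fin m → ZMod p // a ≠ 0} = p ^ m - 1 := by
  classical
  rw [Nat.card_eq_fintype_card, Fintype.card_subtype_compl]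
  simp [ZMod.card]

lemma ratio_lim {m r : ℕ} (hr : r < m) {q : ℕ → ℕ} (hq : Tendsto q atTop atTop) (h1 : ∀ n, 1 < q n) :
    Tendsto (fun n => (((q n ^ (m - r) - 1 : ℕ) : ℝ) * (q n : ℝ) ^ r) / ((q n ^ m - 1 : ℕ) : ℝ)) atTop (𝓝 1) := by
  have hq' : Tendsto (fun n => (q n : ℝ)⁻¹) atTop (𝓝 0) :=
    tendsto_inv_atTop_zero.comp (tendsto_natCast_atTop_atTop.comp hq)
  have a1 : Tendsto (fun n => (1 - ((q n : ℝ)⁻¹)^(m-r)) / (1 - ((q n : ℝ)⁻¹)^m)) atTop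
      (𝓝 ((1 - 0 ^ (m-r)) / (1 - 0^m))) := by
    refine Tendsto.div (tendsto_const_nhds.sub (hq'.pow _)) (tendsto_const_nhds.sub (hq'.pow _)) ?_
    rw [zero_pow (by omega)]; simp
  rw [zero_pow (by omega), zero_pow (by omega)] at a1
  simp only [sub_zero, div_one] at a1
  refine a1.congr fun n => ?_
  have h0 : (0:ℝ) < q n := by exact_mod_cast (h1 n).trans' one_pos
  have e : (q n : ℝ)^m = (q n : ℝ)^(m-r) * (q n : ℝ)^r := by rw [← pow_add]; congr 1; omega
  have h2 : (1:ℝ) < (q n : ℝ)^m := one_lt_pow₀ (by exact_mod_cast h1 n) (by omega)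
  rw [Nat.cast_sub (Nat.one_le_pow _ _ (by have := h1 n; omega)),
    Nat.cast_sub (Nat.one_le_pow _ _ (by have := h1 n; omega))]
  push_cast
  have h3 : (q n : ℝ)^m - 1 ≠ 0 := by linarith
  have h4 : 1 - ((q n : ℝ)^m)⁻¹ ≠ 0 := by
    have := inv_lt_one_of_one_lt₀ h2
    linarith
  rw [inv_pow, inv_pow, div_eq_div_iff h4 h3]
  field_simp
  rw [e]
  ring

lemma scl_tendsto {m : ℕ} (hm : m ≠ 0) {q : ℕ → ℕ} (hq : Tendsto q atTop atTop) :
    Tendsto (fun n => scl m (q n)) atTop atTop := by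
  unfold scl
  exact (tendsto_rpow_atTop (by positivity)).comp (tendsto_natCast_atTop_atTop.comp hq)

lemma hecke_lim {m r : ℕ} (hr : r < m) {A : Set (Fin r → Fin m → ℝ)} (hAm : MeasurableSet A)
    (hAb : IsBounded A) (hAc : Convex ℝ A) (hA0 : 0 ∈ A) (h : SLR m)
    {q : ℕ → ℕ} (hq : Tendsto q atTop atTop) (hqp : ∀ n, Fact (q n).Prime) :
    Tendsto (fun n => Av (sH (cM (m := m) (p := q n))) (Av (sT r) (iF A)) (QuotientGroup.mk h) /
      ((q n ^ m - 1 : ℕ) : ENNReal)) atTop (𝓝 (volume A)) := by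
  set S : Set (Fin r → Fin m → ℝ) := {x | actH h x ∈ A ∩ Ind r m} with hS
  have hSA : S = actH h ⁻¹' A ∩ Ind r m := by
    ext x; simp only [hS, Set.mem_ofPred_eq, Set.mem_inter_iff, actH_Ind_iff, Set.mem_preimage]
  have hpre : actH h ⁻¹' A = actH h⁻¹ '' A := by
    ext x
    constructor
    · intro hx; exact ⟨_, hx, actH_inv h x⟩
    · rintro ⟨y, hy, rfl⟩
      have := actH_inv h⁻¹ y
      rw [inv_inv] at this
      simpa [this] using hy
  have hAb' : IsBounded (actH h ⁻¹' A) := by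
    rw [hpre]
    exact (hAb.isCompact_closure.image (actH_cont h⁻¹)).isBounded.subset (Set.image_mono subset_closure)
  obtain ⟨C, hC0, hC⟩ := hAb'.exists_pos_norm_le
  have hC' : ∀ x, actH h x ∈ A → ∀ i j, |x i j| ≤ C := fun x hx i j =>
    ((norm_le_pi_norm (x i) j).trans (norm_le_pi_norm x i)).trans (hC x hx)
  have hconv : Convex ℝ (actH h ⁻¹' A) := by
    rw [hpre]
    have : actH (r := r) h⁻¹ = (LinearMap.mk ⟨actH (r := r) h⁻¹, fun x y => by
      ext i j; simp [actH, Matrix.mulVec_add]⟩ (fun c x => actH_smul h⁻¹ c x) : (Fin r → Fin m → ℝ) →ₗ[ℝ] (Fin r → Fin m → ℝ)) := rfl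
    rw [this]
    exact hAc.linear_image _
  have h0 : (0 : Fin r → Fin m → ℝ) ∈ actH h ⁻¹' A := by
    have : actH h (0 : Fin r → Fin m → ℝ) = 0 := by ext i j; simp [actH]
    simpa [this] using hA0
  have hlim := count_lim (S := S) (hAb'.subset (by rw [hSA]; exact Set.inter_subset_left))
    (by rw [hSA]; exact ((actH_cont h).measurable hAm).inter (Ind_open r m).measurableSet) ?_ ?_
  · have hvol : volume S = volume A := by
      rw [hSA, measure_inter_conull (Ind_null hr.le), (mp_actH h).measure_preimage hAm.nullMeasurableSet]
    have hfinA : volume A ≠ ⊤ := hAb.measure_lt_top.ne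
    have l1 := (ratio_lim hr hq (fun n => (hqp n).1.one_lt)).mul
      (hlim.comp (scl_tendsto (m := m) (by omega) hq))
    rw [one_mul] at l1
    have l2 := ENNReal.tendsto_ofReal l1
    rw [measureReal_def, hvol, ENNReal.ofReal_toReal hfinA] at l2
    refine l2.congr' ?_
    have hev : ∀ᶠ n in atTop, (r.factorial : ℝ) * C ^ r < scl m (q n) ∧ 1 ≤ scl m (q n) :=
      ((scl_tendsto (by omega) hq).eventually_gt_atTop _).and
        ((scl_tendsto (by omega) hq).eventually_ge_atTop _)
    filter_upwards [hev] with n hn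
    have hs := scl_pow (m := m) (p := q n) (by omega)
    have hspos := scl_pos (m := m) (p := q n)
    rw [hecke_val h hC']
    · simp only [Function.comp_apply]
      have e : scl m (q n) ^ (r * m) = (q n : ℝ) ^ r := by rw [mul_comm, pow_mul, hs]
      have hq1 := (hqp n).1.one_lt
      have hq0 : (0:ℝ) < q n := by exact_mod_cast hq1.trans' one_pos
      have hcpos : 0 < q n ^ m - 1 := Nat.sub_pos_of_lt (Nat.one_lt_pow (by omega) hq1)
      rw [e]
      have e2 : ∀ a b c d : ℝ, 0 < b → a * b / c * (d / b) = a * d / c := by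
        intro a b c d hb; field_simp
      rw [e2 _ _ _ _ (by positivity), ENNReal.ofReal_div_of_pos (by exact_mod_cast hcpos),
        ENNReal.ofReal_mul (by positivity), ENNReal.ofReal_natCast, ENNReal.ofReal_natCast,
        ENNReal.ofReal_natCast]
    · have e3 : scl m (q n) ^ m = scl m (q n) ^ r * scl m (q n) ^ (m - r) := by
        rw [← pow_add]; congr 1; omega
      rw [← hs, e3, mul_pow, ← mul_assoc, mul_comm]
      refine mul_lt_mul_of_pos_left (hn.1.trans_le ?_) (by positivity)
      exact le_self_pow₀ hn.2 (by omega)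
  · rw [hSA]
    refine measure_mono_null (frontier_inter_subset _ _) (measure_union_null ?_ ?_)
    · exact measure_mono_null Set.inter_subset_left (hconv.addHaar_frontier volume)
    · refine measure_mono_null Set.inter_subset_right (measure_mono_null ?_ (Ind_null hr.le))
      rw [(Ind_open r m).frontier_eq]
      exact fun x hx => hx.2
  · intro x y hx hxy
    rintro _ ⟨s, hs, rfl⟩
    have hy : 0 < y := hx.trans_le hxy
    rw [hSA] at hs
    refine ⟨(x / y) • s, ?_, ?_⟩
    · rw [hSA]
      refine ⟨?_, smul_Ind (by positivity) hs.2⟩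
      exact (hconv.starConvex h0).smul_mem hs.1 (by positivity) (by rw [div_le_one hy]; exact hxy)
    · simp only [smul_smul]
      congr 1
      field_simp

end

section

open Filter Topology Pointwise Bornology

lemma sT_m {m r : ℕ} : ∀ v : Fin r → Fin m → ℤ, Measurable fun h : SLR m => sT r h v := sT_meas

lemma sH_m {m : ℕ} {ι : Type*} (c : ι → SLR m) (i : ι) : Measurable fun h => sH c h i :=
  meas_mk.comp (measurable_mul_const (c i))

lemma box_eq {m r : ℕ} (hr : r < m) (μ : Measure (Xspace m)) [IsProbabilityMeasure μ] (hμ : InvM μ)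
    {A : Set (Fin r → Fin m → ℝ)} (hAm : MeasurableSet A)
    (hAb : IsBounded A) (hAc : Convex ℝ A) (hA0 : 0 ∈ A) :
    ∫⁻ x, Av (sT r) (iF A) x ∂μ = volume A := by
  set f := Av (sT (m := m) r) (iF A) with hf
  have hiF : Measurable (iF A) := measurable_one.indicator (hAm.inter (Ind_open r m).measurableSet)
  have hfm : Measurable f := Av_meas (sT_eq r) sT_m hiF
  choose q hqn hqp using Nat.exists_infinite_primes
  have hqt : Tendsto q atTop atTop := tendsto_atTop_mono hqn tendsto_id
  have hqF : ∀ n, Fact (q n).Prime := fun n => ⟨hqp n⟩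
  have hcard : ∀ n, Fintype.card {a : Fin m → ZMod (q n) // a ≠ 0} = q n ^ m - 1 := fun n => by
    rw [← Nat.card_eq_fintype_card, card_idx]
  have hcpos : ∀ n, 0 < q n ^ m - 1 := fun n =>
    Nat.sub_pos_of_lt (Nat.one_lt_pow (by omega) (hqp n).one_lt)
  have hne : ∀ n, Nonempty {a : Fin m → ZMod (q n) // a ≠ 0} := fun n => by
    rw [← Fintype.card_pos_iff, hcard]; exact hcpos n
  let avg : ℕ → (Xspace m → ENNReal) → Xspace m → ENNReal := fun n g x =>
    Av (sH (cM (m := m) (p := q n))) g x / ((q n ^ m - 1 : ℕ) : ENNReal)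
  have hcn0 : ∀ n, ((q n ^ m - 1 : ℕ) : ENNReal) ≠ 0 := fun n => by
    exact_mod_cast (hcpos n).ne'
  have hcnt : ∀ n, ((q n ^ m - 1 : ℕ) : ENNReal) ≠ ⊤ := fun n => ENNReal.natCast_ne_top _
  have havm : ∀ n g, Measurable g → Measurable (avg n g) := fun n g hg =>
    (Av_meas (sH_eq cM_perm) (sH_m _) hg).div_const _
  have hav : ∀ n g, Measurable g → ∫⁻ x, avg n g x ∂μ = ∫⁻ x, g x ∂μ := by
    intro n g hg
    have := hne n
    simp only [avg, div_eq_mul_inv]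
    rw [lintegral_mul_const _ (Av_meas (sH_eq cM_perm) (sH_m _) hg), hecke_avg cM_perm μ hμ hg, hcard,
      mul_comm, ← mul_assoc, ENNReal.inv_mul_cancel (hcn0 n) (hcnt n), one_mul]
  have hlim : ∀ x, Tendsto (fun n => avg n f x) atTop (𝓝 (volume A)) := by
    intro x
    induction x using QuotientGroup.induction_on with | _ h =>
    exact hecke_lim hr hAm hAb hAc hA0 h hqt hqF
  apply le_antisymm
  · have hN : ∀ N : ℕ, ∫⁻ x, min (f x) N ∂μ ≤ volume A := by
      intro N
      have hm : Measurable fun x => min (f x) (N : ENNReal) := hfm.min measurable_const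
      have h1 : ∀ n, ∫⁻ x, min (f x) N ∂μ ≤ ∫⁻ x, min (avg n f x) N ∂μ := by
        intro n
        rw [← hav n _ hm]
        refine lintegral_mono fun x => le_min ?_ ?_
        · refine ENNReal.div_le_div_right ?_ _
          exact ENNReal.tsum_le_tsum fun i => min_le_left _ _
        · refine ENNReal.div_le_of_le_mul ?_
          refine (ENNReal.tsum_le_tsum (g := fun _ => (N : ENNReal)) fun i => min_le_right _ _).trans ?_
          rw [tsum_fintype, Finset.sum_const, Finset.card_univ, hcard, nsmul_eq_mul, mul_comm]
      have h2 : Tendsto (fun n => ∫⁻ x, min (avg n f x) N ∂μ) atTop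
          (𝓝 (∫⁻ x, min (volume A) N ∂μ)) := by
        refine tendsto_lintegral_of_dominated_convergence (fun _ => (N : ENNReal))
          (fun n => (havm n f hfm).min measurable_const)
          (fun n => Eventually.of_forall fun x => min_le_right _ _) ?_
          (Eventually.of_forall fun x => (hlim x).min tendsto_const_nhds)
        simp
      refine (ge_of_tendsto' h2 h1).trans ?_
      simp
    have hsup : ∀ x, f x = ⨆ N : ℕ, min (f x) (N : ENNReal) := by
      intro x
      rw [← inf_iSup_eq, ENNReal.iSup_natCast, inf_top_eq]
    rw [lintegral_congr hsup, lintegral_iSup (fun N => hfm.min measurable_const)]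
    · exact iSup_le hN
    · intro a b hab x
      exact min_le_min le_rfl (by exact_mod_cast hab)
  · calc volume A = ∫⁻ x, liminf (fun n => avg n f x) atTop ∂μ := by
          simp_rw [fun x => (hlim x).liminf_eq]
          simp
      _ ≤ liminf (fun n => ∫⁻ x, avg n f x ∂μ) atTop := lintegral_liminf_le (fun n => havm n f hfm)
      _ = ∫⁻ x, f x ∂μ := by simp_rw [hav _ f hfm]; simp

def C0 : Set (Set ℝ) := {s | MeasurableSet s ∧ IsBounded s ∧ Convex ℝ s ∧ (0:ℝ) ∈ s}

lemma C0_pi : IsPiSystem C0 := fun s hs t ht _ =>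
  ⟨hs.1.inter ht.1, hs.2.1.subset Set.inter_subset_left, hs.2.2.1.inter ht.2.2.1, hs.2.2.2, ht.2.2.2⟩

lemma C0_gen : MeasurableSpace.generateFrom C0 = (inferInstance : MeasurableSpace ℝ) := by
  apply le_antisymm
  · exact MeasurableSpace.generateFrom_le fun s hs => hs.1
  · rw [BorelSpace.measurable_eq (α := ℝ), borel_eq_generateFrom_Iio]
    refine MeasurableSpace.generateFrom_le ?_
    rintro _ ⟨a, rfl⟩
    by_cases ha : 0 < a
    · have : Set.Iio a = ⋃ n : ℕ, Set.Ico (-(n:ℝ)) a := by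
        ext x
        simp only [Set.mem_Iio, Set.mem_iUnion, Set.mem_Ico, exists_and_right]
        refine ⟨fun h => ⟨?_, h⟩, fun h => h.2⟩
        obtain ⟨n, hn⟩ := exists_nat_ge (-x)
        exact ⟨n, by linarith⟩
      rw [this]
      refine MeasurableSet.iUnion fun n => MeasurableSpace.measurableSet_generateFrom ?_
      exact ⟨measurableSet_Ico, Metric.isBounded_Ico _ _, convex_Ico _ _, by simp [ha]⟩
    · have : Set.Iio a = (⋃ n : ℕ, Set.Icc (-(n:ℝ)) 0) \ Set.Icc a 0 := by
        ext x
        simp only [Set.mem_Iio, Set.mem_sdiff, Set.mem_iUnion, Set.mem_Icc, exists_and_right, not_and, not_le]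
        push Not at ha
        refine ⟨fun h => ⟨⟨?_, by linarith⟩, fun h2 => by linarith⟩, fun h => ?_⟩
        · obtain ⟨n, hn⟩ := exists_nat_ge (-x)
          exact ⟨n, by linarith⟩
        · by_contra h2
          push Not at h2
          have := h.2 h2
          linarith [h.1.2]
      rw [this]
      refine MeasurableSet.diff (MeasurableSet.iUnion fun n =>
        MeasurableSpace.measurableSet_generateFrom ?_) (MeasurableSpace.measurableSet_generateFrom ?_)
      · exact ⟨measurableSet_Icc, Metric.isBounded_Icc _ _, convex_Icc _ _, by simp⟩
      · push Not at ha
        exact ⟨measurableSet_Icc, Metric.isBounded_Icc _ _, convex_Icc _ _, by simp [ha]⟩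

def C0_span : (volume : Measure ℝ).FiniteSpanningSetsIn C0 where
  set n := Set.Icc (-(n:ℝ)) n
  set_mem n := ⟨measurableSet_Icc, Metric.isBounded_Icc _ _, convex_Icc _ _, by simp⟩
  finite n := by simp
  spanning := by
    ext x
    simp only [Set.mem_iUnion, Set.mem_Icc, Set.mem_univ, iff_true]
    obtain ⟨n, hn⟩ := exists_nat_ge |x|
    exact ⟨n, abs_le.1 hn⟩

theorem rogers_main {m r : ℕ} (hr : r < m) (μ : Measure (Xspace m)) [IsProbabilityMeasure μ]
    (hμ : InvM μ) {A : Set (Fin r → Fin m → ℝ)} (hAm : MeasurableSet A) :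
    ∫⁻ x, Av (sT r) (iF A) x ∂μ = volume A := by
  have hI := (Ind_open r m).measurableSet
  let ν : Measure (Fin r → Fin m → ℝ) := (μ.bind (qker (sT r))).restrict (Ind r m)
  have hν : ∀ B, MeasurableSet B → ν B = ∫⁻ x, Av (sT r) (iF B) x ∂μ := by
    intro B hB
    have hiF : Measurable (iF B) := measurable_one.indicator (hB.inter hI)
    rw [Measure.restrict_apply hB, ← lintegral_indicator_one (hB.inter hI)]
    exact bind_lint (sT_eq r) sT_m μ hiF
  rw [← hν A hAm]
  let u : (Fin r → Fin m → ℝ) → (Fin r × Fin m → ℝ) := fun x q => x q.1 q.2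
  have hu : Measurable u := (mp_uncurry r m).measurable
  have key : (volume : Measure (Fin r × Fin m → ℝ)) = ν.map u := by
    refine Measure.pi_eq_generateFrom (C := fun _ => C0) (fun _ => C0_gen) (fun _ => C0_pi)
      (fun _ => C0_span) fun s hs => ?_
    have hpre : u ⁻¹' (Set.univ.pi s) = Set.univ.pi fun i => Set.univ.pi fun j => s (i, j) := by
      ext x; simp [u, Set.mem_pi]
    rw [Measure.map_apply hu (MeasurableSet.univ_pi fun q => (hs q).1), hpre, hν, box_eq hr μ hμ]
    · rw [volume_pi_pi, Fintype.prod_prod_type]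
      simp_rw [volume_pi_pi]
    · exact MeasurableSet.univ_pi fun i => MeasurableSet.univ_pi fun j => (hs _).1
    · exact IsBounded.pi fun i => IsBounded.pi fun j => (hs _).2.1
    · exact convex_pi fun i _ => convex_pi fun j _ => (hs _).2.2.1
    · exact fun i _ j _ => (hs _).2.2.2
    · exact MeasurableSet.univ_pi fun i => MeasurableSet.univ_pi fun j => (hs _).1
  let c : (Fin r × Fin m → ℝ) → (Fin r → Fin m → ℝ) := fun x i j => x (i, j)
  have hc : Measurable c := by fun_prop
  have hcA : u ⁻¹' (c ⁻¹' A) = A := rfl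
  have h1 := congrArg (fun M => M (c ⁻¹' A)) key
  simp only [Measure.map_apply hu (hc hAm), hcA] at h1
  rw [← h1, ← (mp_uncurry r m).measure_preimage (hc hAm).nullMeasurableSet]
  rfl

end

section

open Filter Topology Pointwise Bornology

def RB {r m : ℕ} (M : Matrix (Fin r) (Fin r) ℝ) : (Fin r → Fin m → ℝ) →ₗ[ℝ] (Fin r → Fin m → ℝ) where
  toFun y := fun i l => ∑ j, M i j * y j l
  map_add' y z := by ext i l; simp [mul_add, Finset.sum_add_distrib]
  map_smul' c y := by
    ext i l
    simp only [Pi.smul_apply, smul_eq_mul, RingHom.id_apply, Finset.mul_sum]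
    exact Finset.sum_congr rfl fun j _ => by ring

lemma RB_apply {r m : ℕ} (M : Matrix (Fin r) (Fin r) ℝ) (y : Fin r → Fin m → ℝ) (i l) :
    RB M y i l = ∑ j, M i j * y j l := rfl

def swapE (r m : ℕ) : (Fin r → Fin m → ℝ) ≃ₗ[ℝ] (Fin m → Fin r → ℝ) where
  toFun y := fun l j => y j l
  invFun y := fun l j => y j l
  map_add' _ _ := rfl
  map_smul' _ _ := rfl
  left_inv _ := rfl
  right_inv _ := rfl

lemma RB_det {r m : ℕ} (M : Matrix (Fin r) (Fin r) ℝ) :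
    LinearMap.det (RB (m := m) M) = M.det ^ m := by
  rw [← LinearMap.det_conj (RB (m := m) M) (swapE r m)]
  have : ((swapE r m : (Fin r → Fin m → ℝ) →ₗ[ℝ] (Fin m → Fin r → ℝ)) ∘ₗ RB M ∘ₗ
      ((swapE r m).symm : (Fin m → Fin r → ℝ) →ₗ[ℝ] (Fin r → Fin m → ℝ))) =
      LinearMap.pi (fun i => (Matrix.toLin' M).comp (LinearMap.proj i)) := by
    apply LinearMap.ext
    intro y
    ext l i
    rfl
  rw [this, LinearMap.det_pi]
  simp

lemma twist {m r : ℕ} (hr : r < m) (μ : Measure (Xspace m)) [IsProbabilityMeasure μ]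
    (hμ : InvM μ) {A : Set (Fin r → Fin m → ℝ)} (hAm : MeasurableSet A)
    (B : Matrix (Fin r) (Fin r) ℤ) (hB : B.det ≠ 0) :
    ∫⁻ x, Av (sT r) (iF (RB (B.map (Int.cast : ℤ → ℝ)) ⁻¹' A)) x ∂μ =
      ((B.det.natAbs : ENNReal)⁻¹) ^ m * volume A := by
  have hd : (B.map (Int.cast : ℤ → ℝ)).det = (B.det : ℝ) := by
    rw [Int.cast_det]
  have hd0 : (B.det : ℝ) ≠ 0 := by exact_mod_cast hB
  rw [rogers_main hr μ hμ, Measure.addHaar_preimage_linearMap]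
  · rw [RB_det, hd]
    congr 1
    rw [abs_inv, abs_pow, ENNReal.ofReal_inv_of_pos (by positivity), ENNReal.ofReal_pow (by positivity),
      ENNReal.inv_pow]
    congr 3
    rw [← Int.cast_abs, Int.abs_eq_natAbs, Int.cast_natCast, ENNReal.ofReal_natCast]
  · rw [RB_det, hd]; positivity
  · exact (LinearMap.continuous_of_finiteDimensional _).measurable hAm

lemma exists_B {r : ℕ} {ι : Type*} (N : ℕ) (hN : N ≠ 0) (P : ι → Fin r → ℤ) :
    ∃ B : Matrix (Fin r) (Fin r) ℤ, B.det ≠ 0 ∧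
      ∀ c : Fin r → ℤ, (∃ c', B.mulVec c' = c) ↔ ∀ i, (N : ℤ) ∣ ∑ j, P i j * c j := by
  let Λ : Submodule ℤ (Fin r → ℤ) :=
    { carrier := {c | ∀ i, (N : ℤ) ∣ ∑ j, P i j * c j}
      add_mem' := fun {a b} ha hb i => by
        simp only [Pi.add_apply, mul_add, Finset.sum_add_distrib]
        exact dvd_add (ha i) (hb i)
      zero_mem' := fun i => by simp
      smul_mem' := fun c x hx i => by
        have : ∑ j, P i j * (c • x) j = c * ∑ j, P i j * x j := by
          rw [Finset.mul_sum]
          exact Finset.sum_congr rfl fun j _ => by simp; ring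
        rw [this]
        exact Dvd.dvd.mul_left (hx i) c }
  have hmem : ∀ c, c ∈ Λ ↔ ∀ i, (N : ℤ) ∣ ∑ j, P i j * c j := fun c => Iff.rfl
  have hNmem : ∀ c : Fin r → ℤ, (N : ℤ) • c ∈ Λ := fun c i => by
    refine ⟨∑ j, P i j * c j, ?_⟩
    rw [Finset.mul_sum]
    exact Finset.sum_congr rfl fun j _ => by simp; ring
  have hN' : (N : ℤ) ≠ 0 := by exact_mod_cast hN
  have hfr : Module.finrank ℤ Λ = r := by
    apply le_antisymm
    · have := Submodule.finrank_le Λ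
      simpa using this
    · let f : (Fin r → ℤ) →ₗ[ℤ] Λ := LinearMap.codRestrict Λ ((N : ℤ) • LinearMap.id) hNmem
      have hf : Function.Injective f := by
        intro a b hab
        have := congrArg Subtype.val hab
        exact smul_right_injective (Fin r → ℤ) hN' this
      have := LinearMap.finrank_le_finrank_of_injective hf
      simpa using this
  let b := Module.finBasisOfFinrankEq ℤ Λ hfr
  let B : Matrix (Fin r) (Fin r) ℤ := Matrix.of fun i j => (b j : Fin r → ℤ) i
  have hBv : ∀ c', B.mulVec c' = ((∑ j, c' j • b j : Λ) : Fin r → ℤ) := by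
    intro c'
    ext i
    simp [B, Matrix.mulVec, dotProduct, mul_comm]
  have hiff : ∀ c : Fin r → ℤ, (∃ c', B.mulVec c' = c) ↔ ∀ i, (N : ℤ) ∣ ∑ j, P i j * c j := by
    intro c
    rw [← hmem]
    constructor
    · rintro ⟨c', rfl⟩
      rw [hBv]
      exact Subtype.property _
    · intro hc
      refine ⟨b.repr ⟨c, hc⟩, ?_⟩
      rw [hBv, b.sum_repr]
  refine ⟨B, ?_, hiff⟩
  choose M hM using fun j : Fin r => (hiff ((N : ℤ) • Pi.single j 1)).2 ((hmem _).1 (hNmem _))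
  have hBM : B * (Matrix.of fun i j => M j i) = (N : ℤ) • (1 : Matrix (Fin r) (Fin r) ℤ) := by
    ext i j
    have := congrFun (hM j) i
    rw [Matrix.smul_apply, Matrix.one_apply]
    simp only [Pi.smul_apply, Pi.single_apply] at this
    exact this
  intro h0
  have := congrArg Matrix.det hBM
  rw [Matrix.det_mul, h0, zero_mul, Matrix.det_smul, Matrix.det_one, mul_one] at this
  exact (pow_ne_zero _ hN') this.symm

/-- good triple -/
def GoodB {r : ℕ} {ι : Type*} (N : ℕ) (P : ι → Fin r → ℤ) (B : Matrix (Fin r) (Fin r) ℤ) : Prop :=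
  B.det.natAbs = N ∧ N ≠ 0 ∧
    ∀ c : Fin r → ℤ, (∀ i, (N : ℤ) ∣ ∑ j, P i j * c j) → ∃ c', B.mulVec c' = c

lemma exists_good {r : ℕ} {ι : Type*} (N₀ : ℕ) (hN : N₀ ≠ 0) (P₀ : ι → Fin r → ℤ)
    (hP : ∀ i j, |P₀ i j| ≤ N₀) : ∃ (N : ℕ) (P : ι → Fin r → ℤ) (B : Matrix (Fin r) (Fin r) ℤ),
      GoodB N P B ∧ (∀ i j, |P i j| ≤ N) ∧ ∀ i j, (N₀ : ℤ) * P i j = N * P₀ i j := by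
  obtain ⟨B, hB, hBiff⟩ := exists_B N₀ hN P₀
  have hN' : (N₀ : ℤ) ≠ 0 := by exact_mod_cast hN
  have hdvd : ∀ i j, (N₀ : ℤ) ∣ B.det.natAbs * P₀ i j := by
    intro i j
    have h1 : ∃ c', B.mulVec c' = (B.det • Pi.single j 1 : Fin r → ℤ) := by
      refine ⟨B.adjugate.mulVec (Pi.single j 1), ?_⟩
      rw [Matrix.mulVec_mulVec, Matrix.mul_adjugate, Matrix.smul_mulVec, Matrix.one_mulVec]
    have h2 := (hBiff _).1 h1 i
    have h3 : ∑ l, P₀ i l * (B.det • Pi.single j 1 : Fin r → ℤ) l = P₀ i j * B.det := by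
      rw [Finset.sum_eq_single j]
      · simp
      · intro l _ hl; simp [hl]
      · simp
    rw [h3] at h2
    rw [Int.natCast_natAbs, mul_comm]
    rcases abs_choice B.det with h | h <;> rw [h]
    · exact h2
    · rw [mul_neg]; exact (dvd_neg).2 h2
  choose P hP' using hdvd
  refine ⟨B.det.natAbs, P, B, ⟨rfl, by simpa using hB, fun c hc => ?_⟩, fun i j => ?_, fun i j => (hP' i j).symm⟩
  · rw [hBiff]
    intro i
    obtain ⟨t, ht⟩ := hc i
    have hd : (B.det.natAbs : ℤ) ≠ 0 := by simpa using hB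
    refine ⟨t, mul_left_cancel₀ hd ?_⟩
    rw [Finset.mul_sum]
    calc ∑ j, (B.det.natAbs : ℤ) * (P₀ i j * c j) = N₀ * ∑ j, P i j * c j := by
          rw [Finset.mul_sum]
          exact Finset.sum_congr rfl fun j _ => by rw [← mul_assoc, hP']; ring
      _ = _ := by rw [ht]; ring
  · have h1 : (N₀ : ℤ) * |P i j| = B.det.natAbs * |P₀ i j| := by
      have := congrArg abs (hP' i j)
      rw [abs_mul, abs_mul, Nat.abs_cast, Nat.abs_cast] at this
      exact this.symm
    have h2 : (0:ℤ) < N₀ := by positivity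
    have h3 : (N₀ : ℤ) * |P i j| ≤ N₀ * B.det.natAbs := by
      rw [h1, mul_comm (N₀ : ℤ)]
      exact mul_le_mul_of_nonneg_left (hP i j) (by positivity)
    exact le_of_mul_le_mul_left h3 h2

lemma dep_struct {k m : ℕ} (v : Fin k → Fin m → ℤ) : ∃ (r : ℕ) (σ : Fin r ↪ Fin k) (N : ℕ)
    (P : Fin k → Fin r → ℤ), castV (fun j => v (σ j)) ∈ Ind r m ∧ N ≠ 0 ∧
      (∀ i j, |P i j| ≤ N) ∧ ∀ i l, (N : ℤ) * v i l = ∑ j, P i j * v (σ j) l := by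
  classical
  let V := castV v
  obtain ⟨r, hr⟩ : ∃ r, Module.finrank ℝ (Submodule.span ℝ (Set.range V)) = r := ⟨_, rfl⟩
  have hex := Submodule.exists_fun_fin_finrank_span_eq ℝ (Set.range V)
  rw [hr] at hex
  obtain ⟨f, hf, -, hi⟩ := hex
  choose s0 hs0 using hf
  have hfs : f = fun j => V (s0 j) := funext fun j => (hs0 j).symm
  obtain ⟨ρ0, hρ0⟩ := exists_minor hi
  let mn : (Fin r → Fin k) × (Fin r → Fin m) → ℤ := fun q =>
    ((Matrix.of v).submatrix q.1 q.2).det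
  obtain ⟨⟨s, ρ⟩, -, hmax⟩ := Finset.exists_max_image Finset.univ (fun q => |mn q|)
    ⟨(s0, ρ0), Finset.mem_univ _⟩
  have hcast : ∀ q, (mn q : ℝ) = ((Matrix.of V).submatrix q.1 q.2).det := fun q => by
    simp only [mn]; rw [Int.cast_det]; rfl
  have hne0 : mn (s0, ρ0) ≠ 0 := by
    intro h
    apply hρ0
    have := hcast (s0, ρ0)
    rw [h, Int.cast_zero] at this
    rw [hfs]
    exact this.symm
  have hne : mn (s, ρ) ≠ 0 := by
    have := hmax (s0, ρ0) (Finset.mem_univ _)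
    intro h
    rw [h, abs_zero] at this
    exact hne0 (abs_eq_zero.1 (le_antisymm this (abs_nonneg _)))
  have hind : castV (fun j => v (s j)) ∈ Ind r m := by
    refine indep_of_minor ρ ?_
    have := hcast (s, ρ)
    have h2 : ((mn (s, ρ) : ℤ) : ℝ) ≠ 0 := by exact_mod_cast hne
    rw [this] at h2
    exact h2
  have hsinj : Function.Injective s := by
    intro a b hab
    refine LinearIndependent.injective hind ?_
    show (fun l => (v (s a) l : ℝ)) = fun l => (v (s b) l : ℝ)
    rw [hab]
  refine ⟨r, ⟨s, hsinj⟩, (mn (s, ρ)).natAbs, fun i j => (mn (s, ρ)).sign * mn (Function.update s j i, ρ),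
    hind, by simpa using hne, fun i j => ?_, fun i l => ?_⟩
  · rw [abs_mul, Int.abs_sign_of_ne_zero hne, one_mul, Int.natCast_natAbs]
    exact hmax _ (Finset.mem_univ _)
  · -- span
    have hspan : Submodule.span ℝ (Set.range (castV fun j => v (s j))) = Submodule.span ℝ (Set.range V) := by
      apply Submodule.eq_of_le_of_finrank_eq
      · apply Submodule.span_mono
        rintro _ ⟨j, rfl⟩
        exact ⟨s j, rfl⟩
      · rw [hr, finrank_span_eq_card hind, Fintype.card_fin]
    have hvi : V i ∈ Submodule.span ℝ (Set.range (castV fun j => v (s j))) := by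
      rw [hspan]; exact Submodule.subset_span ⟨i, rfl⟩
    rw [Submodule.mem_span_range_iff_exists_fun] at hvi
    obtain ⟨D, hD⟩ := hvi
    have hD' : ∀ l, ∑ j, D j * (v (s j) l : ℝ) = v i l := fun l => by
      have := congrFun hD l
      rw [Finset.sum_apply] at this
      exact this
    have hcr : ∀ j, (mn (Function.update s j i, ρ) : ℝ) = D j * mn (s, ρ) := by
      intro j
      rw [hcast, hcast]
      have e1 : (Matrix.of V).submatrix (Function.update s j i) ρ =
          ((Matrix.of V).submatrix s ρ).updateRow j (∑ a, D a • ((Matrix.of V).submatrix s ρ) a) := by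
        ext a b
        rw [Matrix.updateRow_apply]
        by_cases ha : a = j
        · subst ha
          simp only [Matrix.submatrix_apply, Function.update_self, Matrix.of_apply, if_true]
          rw [Finset.sum_apply]
          simp only [Pi.smul_apply, Matrix.submatrix_apply, Matrix.of_apply, smul_eq_mul]
          exact (hD' (ρ b)).symm
        · simp [ha]
      rw [e1, Matrix.det_updateRow_sum]
      simp
    have : (((mn (s, ρ)).natAbs : ℤ) : ℝ) * v i l
        = ∑ j, (((mn (s, ρ)).sign : ℤ) : ℝ) * (mn (Function.update s j i, ρ) : ℝ) * (v (s j) l : ℝ) := by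
      simp_rw [hcr]
      rw [← hD' l, Finset.mul_sum]
      refine Finset.sum_congr rfl fun j _ => ?_
      have h5 : (((mn (s, ρ)).natAbs : ℤ) : ℝ) = ((mn (s, ρ)).sign : ℝ) * (mn (s, ρ) : ℝ) := by
        rw [Int.natCast_natAbs, ← Int.sign_mul_self_eq_abs]; push_cast; ring
      rw [h5]; ring
    exact_mod_cast this

end

section

open Filter Topology Pointwise Bornology

lemma Ksum (e m : ℕ) (h : e + 2 ≤ m) : ∑' N : ℕ, ((2 * N + 1 : ℕ) : ENNReal) ^ e *
    (if N = 0 then 0 else ((N : ENNReal)⁻¹) ^ m) ≠ ⊤ := by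
  have hs : Summable fun N : ℕ => (3:ℝ) ^ e * ((N : ℝ) ^ 2)⁻¹ :=
    (Real.summable_nat_pow_inv.2 one_lt_two).mul_left _
  refine ne_top_of_le_ne_top hs.tsum_ofReal_ne_top (ENNReal.tsum_le_tsum fun N => ?_)
  split_ifs with hN
  · simp
  have hN1 : (1:ℝ) ≤ N := by exact_mod_cast Nat.one_le_iff_ne_zero.2 hN
  have hN0 : (0:ℝ) < N := by linarith
  rw [← ENNReal.ofReal_natCast, ← ENNReal.ofReal_natCast, ← ENNReal.ofReal_inv_of_pos hN0,
    ← ENNReal.ofReal_pow (by positivity), ← ENNReal.ofReal_pow (by positivity),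
    ← ENNReal.ofReal_mul (by positivity)]
  apply ENNReal.ofReal_le_ofReal
  calc (((2 * N + 1 : ℕ) : ℝ)) ^ e * ((N : ℝ)⁻¹) ^ m ≤ (3 * N) ^ e * ((N : ℝ)⁻¹) ^ (e + 2) := by
        gcongr ?_ * ?_
        · push_cast
          gcongr
          linarith
        · exact pow_le_pow_of_le_one (by positivity) (inv_le_one_of_one_le₀ hN1) h
    _ = 3 ^ e * ((N : ℝ) ^ 2)⁻¹ := by
        rw [mul_pow, pow_add, inv_pow, inv_pow]
        field_simp

abbrev Tq (k : ℕ) := Σ (r : Fin k), (Fin r ↪ Fin k)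
abbrev TP {k : ℕ} (q : Tq k) (N : ℕ) := {i // i ∉ Set.range q.2} → Fin q.1 → Set.Icc (-(N:ℤ)) N
abbrev TT (k : ℕ) := Σ (q : Tq k), Σ N : ℕ, TP q N

def TG {k : ℕ} (t : TT k) (B : Matrix (Fin t.1.1) (Fin t.1.1) ℤ) : Prop :=
  GoodB t.2.1 (fun i j => (t.2.2 i j : ℤ)) B

lemma dep_inj {k m : ℕ} (v : Fin k → Fin m → ℤ) (hv : castV v ∉ Ind k m) :
    ∃ t : TT k, (∃ B, TG t B) ∧ castV (fun j => v (t.1.2 j)) ∈ Ind t.1.1 m ∧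
      ∀ (i : {i // i ∉ Set.range t.1.2}) l,
        (t.2.1 : ℤ) * v i l = ∑ j, (t.2.2 i j : ℤ) * v (t.1.2 j) l := by
  obtain ⟨r, σ, N₀, P₀, hi, hN, hP, hr⟩ := dep_struct v
  have hrk : r < k := by
    have h1 : r ≤ k := by simpa using Fintype.card_le_of_embedding σ
    refine lt_of_le_of_ne h1 ?_
    rintro rfl
    apply hv
    have hb : Function.Bijective σ := Finite.injective_iff_bijective.1 σ.injective
    let e := Equiv.ofBijective σ hb
    have := LinearIndependent.comp hi e.symm e.symm.injective
    have h2 : (castV (fun j => v (σ j))) ∘ e.symm = castV v := by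
      funext i l
      show ((v (e (e.symm i)) l : ℤ) : ℝ) = v i l
      rw [e.apply_symm_apply]
    rw [h2] at this
    exact this
  obtain ⟨N, P, B, hG, hPN, hPP⟩ := exists_good (ι := {i // i ∉ Set.range σ}) N₀ hN
    (fun i j => P₀ i j) (fun i j => hP i j)
  refine ⟨⟨⟨⟨r, hrk⟩, σ⟩, N, fun i j => ⟨P i j, abs_le.1 (hPN i j)⟩⟩, ⟨B, hG⟩, hi, fun i l => ?_⟩
  have hN' : (N₀ : ℤ) ≠ 0 := by exact_mod_cast hN
  apply mul_left_cancel₀ hN'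
  show (N₀:ℤ) * (N * v i l) = N₀ * ∑ j, P i j * v (σ j) l
  rw [mul_left_comm, hr, Finset.mul_sum, Finset.mul_sum]
  refine Finset.sum_congr rfl fun j _ => ?_
  rw [← mul_assoc, ← mul_assoc, hPP]

open Classical in
def BT {k : ℕ} (t : TT k) : Matrix (Fin t.1.1) (Fin t.1.1) ℤ :=
  if h : ∃ B, TG t B then h.choose else 0

lemma BT_spec {k : ℕ} (t : TT k) (h : ∃ B, TG t B) : TG t (BT t) := by
  rw [BT, dif_pos h]; exact h.choose_spec

open Classical in
def cT {k m : ℕ} (A : (r : ℕ) → Set (Fin r → Fin m → ℝ)) (t : TT k) : Xspace m → ENNReal :=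
  if ∃ B, TG t B then Av (sT t.1.1) (iF (RB ((BT t).map (Int.cast : ℤ → ℝ)) ⁻¹' A t.1.1)) else 0

lemma iF_meas {r m : ℕ} {A : Set (Fin r → Fin m → ℝ)} (hA : MeasurableSet A) : Measurable (iF A) :=
  measurable_one.indicator (hA.inter (Ind_open r m).measurableSet)

lemma RB_meas {r m : ℕ} (M : Matrix (Fin r) (Fin r) ℝ) : Measurable (RB (m := m) M) :=
  (LinearMap.continuous_of_finiteDimensional _).measurable

lemma cT_meas {k m : ℕ} {A : (r : ℕ) → Set (Fin r → Fin m → ℝ)} (hA : ∀ r, MeasurableSet (A r))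
    (t : TT k) : Measurable (cT A t) := by
  unfold cT
  split_ifs
  · exact Av_meas (sT_eq _) sT_m (iF_meas (RB_meas _ (hA _)))
  · exact measurable_zero

lemma cT_int {k m : ℕ} (hk : k < m) (μ : Measure (Xspace m)) [IsProbabilityMeasure μ]
    (hμ : InvM μ) {A : (r : ℕ) → Set (Fin r → Fin m → ℝ)} (hA : ∀ r, MeasurableSet (A r))
    (t : TT k) : ∫⁻ x, cT A t x ∂μ ≤
      (if t.2.1 = 0 then 0 else ((t.2.1 : ENNReal)⁻¹) ^ m) * volume (A t.1.1) := by
  unfold cT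
  split_ifs with h h2 h2
  · exact absurd h2 (BT_spec t h).2.1
  · have hB := BT_spec t h
    rw [twist (t.1.1.2.trans hk) μ hμ (hA _) (BT t) ?_, hB.1]
    intro h0
    apply hB.2.1
    rw [← hB.1, h0]; rfl
  · simp
  · simp

lemma actH_RB {m r : ℕ} (h : SLR m) (M : Matrix (Fin r) (Fin r) ℝ) (y : Fin r → Fin m → ℝ) :
    RB M (actH h y) = actH h (RB M y) := by
  ext i l
  simp only [RB_apply, actH, Matrix.mulVec, dotProduct, Finset.mul_sum]
  rw [Finset.sum_comm]
  exact Finset.sum_congr rfl fun a _ => Finset.sum_congr rfl fun b _ => by ring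

lemma Ind_of_RB {m r : ℕ} (M : Matrix (Fin r) (Fin r) ℝ) (y : Fin r → Fin m → ℝ)
    (h : RB M y ∈ Ind r m) : y ∈ Ind r m := by
  have h1 : Module.finrank ℝ (Submodule.span ℝ (Set.range (RB M y))) = r := by
    rw [finrank_span_eq_card h, Fintype.card_fin]
  have h2 : Submodule.span ℝ (Set.range (RB M y)) ≤ Submodule.span ℝ (Set.range y) := by
    rw [Submodule.span_le]
    rintro _ ⟨i, rfl⟩
    have : RB M y i = ∑ j, M i j • y j := by
      ext l; simp [RB_apply]
    rw [this]
    exact Submodule.sum_mem _ fun j _ => Submodule.smul_mem _ _ (Submodule.subset_span ⟨j, rfl⟩)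
  have h3 := Submodule.finrank_mono h2
  refine linearIndependent_iff_card_le_finrank_span.2 ?_
  rw [h1] at h3
  simpa [Set.finrank] using h3

lemma dep_le {k m : ℕ} {E : Set (Fin k → Fin m → ℝ)} {A : (r : ℕ) → Set (Fin r → Fin m → ℝ)}
    (hEA : ∀ r, r < k → ∀ σ : Fin r ↪ Fin k, ∀ v ∈ E, (fun j => v (σ j)) ∈ A r) (x : Xspace m) :
    Av (sT k) ((E \ Ind k m).indicator 1) x ≤ ∑' t : TT k, cT A t x := by
  induction x using QuotientGroup.induction_on with | _ h =>
  rw [Av_mk (sT_eq k)]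
  let S : Set (Fin k → Fin m → ℤ) := {v | sT k h v ∈ E \ Ind k m}
  have e1 : ∀ v, ((E \ Ind k m).indicator 1 (sT k h v) : ENNReal) = S.indicator (fun _ => 1) v := by
    intro v
    by_cases hv : sT k h v ∈ E \ Ind k m
    · rw [Set.indicator_of_mem hv, Set.indicator_of_mem (show v ∈ S from hv)]; rfl
    · rw [Set.indicator_of_notMem hv, Set.indicator_of_notMem (show v ∉ S from hv)]
  simp_rw [e1]
  rw [← tsum_subtype S (fun _ => (1 : ENNReal))]
  let G : (Σ t : TT k, (Fin t.1.1 → Fin m → ℤ)) → ENNReal := fun q =>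
    open Classical in
    if ∃ B, TG q.1 B then
      iF (RB ((BT q.1).map (Int.cast : ℤ → ℝ)) ⁻¹' A q.1.1.1) (sT q.1.1.1 h q.2) else 0
  have e2 : ∑' t : TT k, cT A t (QuotientGroup.mk h : Xspace m) = ∑' q, G q := by
    rw [ENNReal.tsum_sigma' G]
    refine tsum_congr fun t => ?_
    unfold cT
    by_cases ht : ∃ B, TG t B
    · rw [if_pos ht, Av_mk (sT_eq _)]
      refine tsum_congr fun y => ?_
      simp only [G]
      rw [if_pos ht]
    · rw [if_neg ht]
      simp only [G]
      simp [ht]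
  rw [e2]
  have key : ∀ v : S, ∃ q : (Σ t : TT k, (Fin t.1.1 → Fin m → ℤ)), G q = 1 ∧
      (q.1.2.1 ≠ 0) ∧
      (∀ j l, v.1 (q.1.1.2 j) l = ∑ a, BT q.1 j a * q.2 a l) ∧
      ∀ (i : {i // i ∉ Set.range q.1.1.2}) l,
        (q.1.2.1 : ℤ) * v.1 i l = ∑ j, (q.1.2.2 i j : ℤ) * v.1 (q.1.1.2 j) l := by
    rintro ⟨v, hvE, hvI⟩
    have hvI' : castV v ∉ Ind k m := fun hh => hvI ((actH_Ind_iff h).2 hh)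
    obtain ⟨t, ht, hti, htr⟩ := dep_inj v hvI'
    have hB := BT_spec t ht
    have hy : ∀ l, ∃ c', (BT t).mulVec c' = fun j => v (t.1.2 j) l := fun l =>
      hB.2.2 _ fun i => ⟨v i l, (htr i l).symm⟩
    choose y hy using hy
    refine ⟨⟨t, fun j l => y l j⟩, ?_, hB.2.1, fun j l => (congrFun (hy l) j).symm, htr⟩
    simp only [G]
    rw [if_pos ht]
    have h5 : RB ((BT t).map (Int.cast : ℤ → ℝ)) (castV fun j l => y l j) =
        castV fun j => v (t.1.2 j) := by
      ext j l
      have := congrFun (hy l) j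
      simp only [RB_apply, castV, Matrix.map_apply]
      rw [← this]
      simp [Matrix.mulVec, dotProduct]
    have h6 : sT t.1.1 h (fun j l => y l j) ∈
        (RB ((BT t).map (Int.cast : ℤ → ℝ)) ⁻¹' A t.1.1) ∩ Ind t.1.1 m := by
      rw [sT_actH]
      refine ⟨?_, (actH_Ind_iff h).2 (Ind_of_RB _ _ (by rw [h5]; exact hti))⟩
      rw [Set.mem_preimage, actH_RB, h5]
      exact hEA _ t.1.1.2 t.1.2 _ hvE
    rw [iF, Set.indicator_of_mem h6]; rfl
  choose f hf1 hf0 hf2 hf3 using key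
  have hinj : Function.Injective f := by
    intro v w hvw
    have hw2 := hf2 w
    have hw3 := hf3 w
    rw [← hvw] at hw2 hw3
    apply Subtype.ext
    funext i l
    have hσ : ∀ j l, v.1 ((f v).1.1.2 j) l = w.1 ((f v).1.1.2 j) l := fun j l => by
      rw [hf2 v, hw2]
    by_cases hi : i ∈ Set.range (f v).1.1.2
    · obtain ⟨j, rfl⟩ := hi
      exact hσ j l
    · have h0 : ((f v).1.2.1 : ℤ) ≠ 0 := by exact_mod_cast hf0 v
      apply mul_left_cancel₀ h0
      rw [hf3 v ⟨i, hi⟩ l, hw3 ⟨i, hi⟩ l]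
      exact Finset.sum_congr rfl fun j _ => by rw [hσ]
  calc ∑' v : S, (1 : ENNReal) = ∑' v : S, G (f v) := tsum_congr fun v => (hf1 v).symm
    _ ≤ _ := ENNReal.tsum_comp_le_tsum_of_injective hinj G

theorem rogers_bound {k m : ℕ} (hk : k < m) (he : ∀ r, r < k → (k - r) * r + 2 ≤ m) :
    ∃ K : ENNReal, K ≠ ⊤ ∧ ∀ (μ : Measure (Xspace m)) [IsProbabilityMeasure μ], InvM μ →
      ∀ (E : Set (Fin k → Fin m → ℝ)) (A : (r : ℕ) → Set (Fin r → Fin m → ℝ)),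
      MeasurableSet E → (∀ r, MeasurableSet (A r)) →
      (∀ r, r < k → ∀ σ : Fin r ↪ Fin k, ∀ v ∈ E, (fun j => v (σ j)) ∈ A r) →
      volume E ≤ ∫⁻ x, Av (sT k) (E.indicator 1) x ∂μ ∧
      ∫⁻ x, Av (sT k) (E.indicator 1) x ∂μ ≤ volume E + K * ∑ r ∈ Finset.range k, volume (A r) := by
  classical
  let W : Tq k → ENNReal := fun q => ∑' N : ℕ, ((2 * N + 1 : ℕ) : ENNReal) ^ ((k - q.1) * q.1) *
    (if N = 0 then 0 else ((N : ENNReal)⁻¹) ^ m)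
  refine ⟨∑ q, W q, ?_, ?_⟩
  · exact (ENNReal.sum_lt_top.2 fun q _ => lt_top_iff_ne_top.2 (Ksum _ _ (he _ q.1.2))).ne
  intro μ _ hμ E A hE hA hEA
  have hI := (Ind_open k m).measurableSet
  have hsplit : ∀ x, Av (sT k) (E.indicator 1) x = Av (sT k) (iF E) x +
      Av (sT k) ((E \ Ind k m).indicator 1) x := by
    intro x
    simp only [Av]
    rw [← ENNReal.tsum_add]
    refine tsum_congr fun v => ?_
    generalize sT k (Quotient.out x) v = y
    by_cases h1 : y ∈ E <;> by_cases h2 : y ∈ Ind k m <;> simp [iF, Set.indicator, h1, h2]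
  have hint : ∫⁻ x, Av (sT k) (E.indicator 1) x ∂μ = volume E +
      ∫⁻ x, Av (sT k) ((E \ Ind k m).indicator 1) x ∂μ := by
    simp_rw [hsplit]
    rw [lintegral_add_left (Av_meas (sT_eq _) sT_m (iF_meas hE)), rogers_main hk μ hμ hE]
  rw [hint]
  refine ⟨le_self_add, ?_⟩
  gcongr
  calc ∫⁻ x, Av (sT k) ((E \ Ind k m).indicator 1) x ∂μ
      ≤ ∫⁻ x, ∑' t : TT k, cT A t x ∂μ := lintegral_mono (dep_le hEA)
    _ = ∑' t : TT k, ∫⁻ x, cT A t x ∂μ := lintegral_tsum fun t => (cT_meas hA t).aemeasurable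
    _ ≤ ∑' t : TT k, (if t.2.1 = 0 then 0 else ((t.2.1 : ENNReal)⁻¹) ^ m) * volume (A t.1.1) :=
        ENNReal.tsum_le_tsum fun t => cT_int hk μ hμ hA t
    _ = ∑ q : Tq k, W q * volume (A q.1) := by
        rw [ENNReal.tsum_sigma', tsum_fintype]
        refine Finset.sum_congr rfl fun q _ => ?_
        rw [ENNReal.tsum_sigma', ← ENNReal.tsum_mul_right]
        refine tsum_congr fun N => ?_
        show ∑' b : TP q N, ((if N = 0 then (0:ENNReal) else (N:ENNReal)⁻¹ ^ m) * volume (A q.1)) = _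
        rw [tsum_fintype, Finset.sum_const, nsmul_eq_mul, ← mul_assoc]
        congr 2
        have hc : Fintype.card {i // i ∉ Set.range q.2} = k - q.1 := by
          have h7 : Fintype.card {i // i ∈ Set.range q.2} = q.1 := by
            have := Fintype.card_congr (Equiv.ofInjective q.2 q.2.injective)
            rw [Fintype.card_fin] at this
            refine Eq.trans ?_ this.symm
            exact Fintype.card_congr (Equiv.refl _)
          rw [Fintype.card_subtype_compl, Fintype.card_fin, h7]
        have hc2 : Fintype.card (Set.Icc (-(N:ℤ)) N) = 2 * N + 1 := by
          rw [Fintype.card_ofFinset, Int.card_Icc]; omega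
        rw [Finset.card_univ, Fintype.card_pi, Finset.prod_const, Fintype.card_pi, Finset.prod_const,
          Finset.card_univ, Finset.card_univ, Fintype.card_fin, hc, hc2, ← pow_mul, mul_comm (q.1 : ℕ)]
        push_cast
        rfl
    _ ≤ ∑ q : Tq k, W q * ∑ r ∈ Finset.range k, volume (A r) := by
        gcongr with q
        exact Finset.single_le_sum (f := fun r => volume (A r)) (fun _ _ => zero_le)
          (Finset.mem_range.2 q.1.2)
    _ = _ := by rw [Finset.sum_mul]

end

section

open Filter Topology Pointwise Bornology

instance i1 : SigmaFinite (volume : Measure (ℝ×ℝ)) := inferInstance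
instance i2 (n: ℕ): SigmaFinite (volume : Measure (Fin n → ℝ×ℝ)) := inferInstance
instance i3 (r n: ℕ): SigmaFinite (volume : Measure (Fin r → Fin n → ℝ×ℝ)) := inferInstance
instance i4 (r n: ℕ): SigmaFinite ((volume : Measure ((Fin r → Fin n → ℝ×ℝ))).prod
    (volume: Measure (Fin r → ℝ))) := Measure.prod.instSigmaFinite
instance i5 (r n: ℕ): SigmaFinite (volume : Measure ((Fin r → Fin n → ℝ×ℝ)× (Fin r → ℝ))) := i4 r n
instance i6 (r n: ℕ): SFinite (volume : Measure ((Fin r → Fin n → ℝ×ℝ)× (Fin r → ℝ))) := inferInstance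

def omg {n : ℕ} (x y : Fin n → ℝ × ℝ) : ℝ := ∑ a, ((x a).1 * (y a).2 - (x a).2 * (y a).1)

lemma omg_self {n : ℕ} (x : Fin n → ℝ × ℝ) : omg x x = 0 :=
  Finset.sum_eq_zero fun a _ => by ring

lemma omg_comm {n : ℕ} (x y : Fin n → ℝ × ℝ) : omg x y = - omg y x := by
  simp only [omg, ← Finset.sum_neg_distrib]
  exact Finset.sum_congr rfl fun a _ => by ring

lemma omg_sub_left {n : ℕ} (x y z : Fin n → ℝ × ℝ) : omg (x - y) z = omg x z - omg y z := by
  simp only [omg, ← Finset.sum_sub_distrib]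
  exact Finset.sum_congr rfl fun a _ => by simp only [Pi.sub_apply, Prod.fst_sub, Prod.snd_sub]; ring

lemma omg_smul_left {n : ℕ} (t : ℝ) (x z : Fin n → ℝ × ℝ) : omg (t • x) z = t * omg x z := by
  simp only [omg, Finset.mul_sum]
  exact Finset.sum_congr rfl fun a _ => by
    simp only [Pi.smul_apply, Prod.smul_fst, Prod.smul_snd, smul_eq_mul]; ring

lemma omg_sub_right {n : ℕ} (x y z : Fin n → ℝ × ℝ) : omg z (x - y) = omg z x - omg z y := by
  rw [omg_comm, omg_sub_left, omg_comm x, omg_comm y]; ring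

lemma omg_smul_right {n : ℕ} (t : ℝ) (x z : Fin n → ℝ × ℝ) : omg z (t • x) = t * omg z x := by
  rw [omg_comm, omg_smul_left, omg_comm x]; ring

lemma omg_cont {n : ℕ} {X : Type*} [TopologicalSpace X] {f g : X → Fin n → ℝ × ℝ}
    (hf : Continuous f) (hg : Continuous g) : Continuous fun x => omg (f x) (g x) := by
  unfold omg
  fun_prop

def VS (n r : ℕ) (R L : ℝ) (c : Fin r → Fin r → ℝ) : Set (Fin r → Fin n → ℝ × ℝ) :=
  {x | (∀ j, ‖x j‖ ≤ R) ∧ ∀ i j, i < j → omg (x i) (x j) ∈ Set.Icc (c i j) (c i j + L)}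

lemma VS_closed (n r : ℕ) (R L : ℝ) (c : Fin r → Fin r → ℝ) : IsClosed (VS n r R L c) := by
  have : VS n r R L c = (⋂ j, {x | ‖x j‖ ≤ R}) ∩ ⋂ i, ⋂ j, ⋂ (_ : i < j),
      (fun x => omg (x i) (x j)) ⁻¹' Set.Icc (c i j) (c i j + L) := by
    ext x; simp [VS]
  rw [this]
  refine IsClosed.inter (isClosed_iInter fun j => isClosed_le (by fun_prop) (by fun_prop))
    (isClosed_iInter fun i => isClosed_iInter fun j => isClosed_iInter fun _ =>
      isClosed_Icc.preimage (omg_cont (by fun_prop) (by fun_prop)))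

lemma prod_bound {α β : Type*} [MeasurableSpace α] [MeasurableSpace β] (μ : Measure α) (ν : Measure β)
    [SFinite ν] {Z : Set (α × β)} (hZ : MeasurableSet Z) {B : Set α} (hB : MeasurableSet B)
    {V : ENNReal} (h1 : ∀ x ∈ B, ν (Prod.mk x ⁻¹' Z) ≤ V) (h2 : ∀ q ∈ Z, q.1 ∈ B) :
    (μ.prod ν) Z ≤ μ B * V := by
  rw [Measure.prod_apply hZ]
  calc ∫⁻ x, ν (Prod.mk x ⁻¹' Z) ∂μ ≤ ∫⁻ x, B.indicator (fun _ => V) x ∂μ := by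
        refine lintegral_mono fun x => ?_
        by_cases hx : x ∈ B
        · rw [Set.indicator_of_mem hx]; exact h1 x hx
        · have : Prod.mk x ⁻¹' Z = ∅ := by
            ext y
            simp only [Set.mem_preimage, Set.mem_empty_iff_false, iff_false]
            exact fun h => hx (h2 _ h)
          simp [this]
    _ = _ := by rw [lintegral_indicator hB, setLIntegral_const, mul_comm]

abbrev PYT (n r : ℕ) := (Fin r → ℝ) × ((Fin r → Fin n → ℝ × ℝ) × (Fin r → ℝ))

def IS (n r : ℕ) (R L α β : ℝ) (u : Fin n → ℝ × ℝ) (d : Fin r → ℝ) (c : Fin r → Fin r → ℝ) :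
    Set (PYT n r) :=
  {w | (∀ j, |w.1 j| ≤ R) ∧ (∀ j, ‖w.2.1 j‖ ≤ R) ∧
    (∀ j, α * w.2.2 j - β * w.1 j + omg u (w.2.1 j) ∈ Set.Icc (d j) (d j + L)) ∧
    ∀ i j, i < j → w.1 i * w.2.2 j - w.2.2 i * w.1 j + omg (w.2.1 i) (w.2.1 j)
      ∈ Set.Icc (c i j) (c i j + L)}

lemma IS_closed (n r : ℕ) (R L α β : ℝ) (u : Fin n → ℝ × ℝ) (d : Fin r → ℝ)
    (c : Fin r → Fin r → ℝ) : IsClosed (IS n r R L α β u d c) := by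
  have : IS n r R L α β u d c = (⋂ j, {w | |w.1 j| ≤ R}) ∩ ((⋂ j, {w | ‖w.2.1 j‖ ≤ R}) ∩
    ((⋂ j, (fun w : PYT n r => α * w.2.2 j - β * w.1 j + omg u (w.2.1 j)) ⁻¹' Set.Icc (d j) (d j + L)) ∩
    ⋂ i, ⋂ j, ⋂ (_ : i < j),
      (fun w : PYT n r => w.1 i * w.2.2 j - w.2.2 i * w.1 j + omg (w.2.1 i) (w.2.1 j)) ⁻¹'
        Set.Icc (c i j) (c i j + L))) := by
    ext x; simp [IS]
  rw [this]
  refine IsClosed.inter (isClosed_iInter fun j => isClosed_le (by fun_prop) (by fun_prop))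
    (IsClosed.inter (isClosed_iInter fun j => isClosed_le (by fun_prop) (by fun_prop))
    (IsClosed.inter (isClosed_iInter fun j => isClosed_Icc.preimage ?_)
    (isClosed_iInter fun i => isClosed_iInter fun j => isClosed_iInter fun _ =>
      isClosed_Icc.preimage ?_)))
  · have := omg_cont (X := PYT n r) (f := fun _ => u) (g := fun w => w.2.1 j) (by fun_prop) (by fun_prop)
    fun_prop
  · have := omg_cont (X := PYT n r) (f := fun w => w.2.1 i) (g := fun w => w.2.1 j) (by fun_prop) (by fun_prop)
    fun_prop

/-- the shear -/
def shear {n r : ℕ} (κ : ℝ) (z : Fin n → ℝ × ℝ) (w : PYT n r) : PYT n r :=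
  (w.1, (fun j => w.2.1 j - w.1 j • z, fun j => w.2.2 j + (omg z (w.2.1 j) - κ * w.1 j)))

lemma shear_mp {n r : ℕ} (κ : ℝ) (z : Fin n → ℝ × ℝ) :
    MeasurePreserving (shear (n := n) (r := r) κ z) volume volume := by
  have hc : Continuous (shear (n := n) (r := r) κ z) := by
    unfold shear
    have := fun j => omg_cont (X := PYT n r) (f := fun _ => z) (g := fun w => w.2.1 j)
      (by fun_prop) (by fun_prop)
    fun_prop
  have hc2 : Continuous fun w : PYT n r => (shear κ z w).2 := continuous_snd.comp hc
  refine MeasurePreserving.skew_product (g := fun p yt => (shear κ z (p, yt)).2)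
    (MeasurePreserving.id volume) hc2.measurable (Eventually.of_forall fun p => ?_)
  have h2 : MeasurePreserving (fun yt : (Fin r → Fin n → ℝ × ℝ) × (Fin r → ℝ) =>
      (yt.1 + (fun j => - (p j • z)), yt.2 + (fun j => omg z (yt.1 j) - κ * p j)))
      (volume.prod volume) (volume.prod volume) := by
    refine MeasurePreserving.skew_product
      (g := fun (y : Fin r → Fin n → ℝ × ℝ) (t : Fin r → ℝ) => t + (fun j => omg z (y j) - κ * p j))
      (measurePreserving_add_right volume _) ?_ (Eventually.of_forall fun y =>
        (measurePreserving_add_right volume _).map_eq)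
    apply Continuous.measurable
    have := fun j => omg_cont (X := (Fin r → Fin n → ℝ × ℝ) × (Fin r → ℝ)) (f := fun _ => z)
      (g := fun w => w.1 j) (by fun_prop) (by fun_prop)
    unfold Function.uncurry
    fun_prop
  have h3 : (fun yt => (shear (n := n) (r := r) κ z (p, yt)).2) =
    (fun yt : (Fin r → Fin n → ℝ × ℝ) × (Fin r → ℝ) =>
      (yt.1 + (fun j => - (p j • z)), yt.2 + (fun j => omg z (yt.1 j) - κ * p j))) := by
    funext yt
    simp only [shear, sub_eq_add_neg]
    rfl
  rw [h3]
  exact h2.map_eq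

lemma IS_bound {n r : ℕ} {R L α β : ℝ} (hR : 0 < R) (hL : 0 < L) (hα : α ≠ 0)
    {u : Fin n → ℝ × ℝ} (hu : ‖u‖ ≤ |α|) (d : Fin r → ℝ) (c : Fin r → Fin r → ℝ) {V : ENNReal}
    (hV : ∀ c', volume (VS n r (2 * R) L c') ≤ V) :
    volume (IS n r R L α β u d c) ≤
      ENNReal.ofReal (2 * R) ^ r * (ENNReal.ofReal (L / |α|) ^ r * V) := by
  let z := α⁻¹ • u
  have hz : ‖z‖ ≤ 1 := by
    rw [norm_smul, norm_inv, Real.norm_eq_abs, inv_mul_le_one₀ (abs_pos.2 hα)]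
    exact hu
  let κ := β / α
  let JS : Set (PYT n r) := {w | (∀ j, |w.1 j| ≤ R)} ∩ IS n r (2 * R) L α 0 0 d c
  have hJc : IsClosed JS := by
    refine IsClosed.inter ?_ (IS_closed _ _ _ _ _ _ _ _ _)
    have : {w : PYT n r | (∀ j, |w.1 j| ≤ R)} = ⋂ j, {w | |w.1 j| ≤ R} := by ext; simp
    rw [this]
    exact isClosed_iInter fun j => isClosed_le (by fun_prop) (by fun_prop)
  have hsub : IS n r R L α β u d c ⊆ shear κ z ⁻¹' JS := by
    rintro ⟨p, y, t⟩ ⟨h1, h2, h3, h4⟩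
    refine ⟨h1, fun j => (h1 j).trans (by linarith), fun j => ?_, fun j => ?_, fun i j hij => ?_⟩
    · refine (norm_sub_le _ _).trans ?_
      rw [norm_smul]
      have := h1 j
      have h5 : |p j| * ‖z‖ ≤ R * 1 := mul_le_mul this hz (norm_nonneg _) hR.le
      have h6 := h2 j
      simp only [Real.norm_eq_abs] at *
      linarith
    · have := h3 j
      simp only [shear] at *
      convert this using 1
      have h0 : omg (0 : Fin n → ℝ × ℝ) (y j - p j • z) = 0 := by simp [omg]
      rw [h0]
      simp only [z, κ, omg_smul_left]
      field_simp
      ring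
    · have := h4 i j hij
      simp only [shear] at *
      convert this using 1
      clear_value z
      simp only [omg_sub_left, omg_sub_right, omg_smul_left, omg_smul_right, omg_self]
      rw [omg_comm (y i) z]
      ring
  have hmp := shear_mp (n := n) (r := r) κ z
  refine (measure_mono hsub).trans ?_
  rw [hmp.measure_preimage hJc.measurableSet.nullMeasurableSet]
  have hP : volume (Set.univ.pi fun _ : Fin r => Set.Icc (-R) R) = ENNReal.ofReal (2 * R) ^ r := by
    rw [volume_pi_pi]
    simp only [Real.volume_Icc, Finset.prod_const, Finset.card_univ, Fintype.card_fin]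
    ring_nf
  rw [← hP]
  refine prod_bound (volume : Measure (Fin r → ℝ)) volume hJc.measurableSet
    (MeasurableSet.univ_pi fun _ => measurableSet_Icc) (fun p hp => ?_)
    (fun q hq j _ => abs_le.1 (hq.1 j))
  have hT : volume (Set.univ.pi fun j : Fin r => (fun t => α * t) ⁻¹' Set.Icc (d j) (d j + L)) =
      ENNReal.ofReal (L / |α|) ^ r := by
    rw [volume_pi_pi]
    have : ∀ j, volume ((fun t => α * t) ⁻¹' Set.Icc (d j) (d j + L)) = ENNReal.ofReal (L / |α|) := by
      intro j
      rw [Real.volume_preimage_mul_left hα, Real.volume_Icc, ← ENNReal.ofReal_mul (by positivity)]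
      congr 1
      rw [abs_inv]; field_simp; ring
    simp [this]
  rw [← hT]
  rw [Measure.volume_eq_prod, ← Measure.prod_swap, Measure.map_apply measurable_swap]
  · refine prod_bound (volume : Measure (Fin r → ℝ)) volume ?_ ?_ (fun t ht => ?_) (fun q hq j _ => ?_)
    · exact ((hJc.preimage (by fun_prop)).preimage continuous_swap).measurableSet
    · exact MeasurableSet.univ_pi fun _ => measurableSet_Icc.preimage (by fun_prop)
    · refine (measure_mono ?_).trans (hV (fun i j => c i j - (p i * t j - t i * p j)))
      intro y hy
      obtain ⟨-, -, h2, -, h4⟩ := hy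
      refine ⟨h2, fun i j hij => ?_⟩
      have := h4 i j hij
      simp only [Set.mem_Icc, Prod.fst_swap, Prod.snd_swap] at *
      constructor <;> linarith [this.1, this.2]
    · have := hq.2.2.2.1 j
      simpa [omg] using this
  · exact (hJc.preimage (by fun_prop)).measurableSet

end

section

open Filter Topology Pointwise Bornology

lemma mp_base (n r : ℕ) (i : Fin (n + 1)) : MeasurePreserving
    (fun x : Fin r → Fin (n + 1) → ℝ × ℝ =>
      (((fun j => (x j i).1, fun j => (x j i).2), fun j a => x j (i.succAbove a)) :
        ((Fin r → ℝ) × (Fin r → ℝ)) × (Fin r → Fin n → ℝ × ℝ))) volume volume := by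
  have h1 := volume_preserving_pi (ι := Fin r) (fun _ => volume_preserving_piFinSuccAbove (fun _ : Fin (n + 1) => ℝ × ℝ) i)
  have h2 := volume_measurePreserving_arrowProdEquivProdArrow (ℝ × ℝ) (Fin n → ℝ × ℝ) (Fin r)
  have h3 := volume_measurePreserving_arrowProdEquivProdArrow ℝ ℝ (Fin r)
  have h4 : MeasurePreserving (Prod.map (MeasurableEquiv.arrowProdEquivProdArrow ℝ ℝ (Fin r)) id)
    ((volume : Measure (Fin r → ℝ × ℝ)).prod (volume : Measure (Fin r → Fin n → ℝ × ℝ)))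
    (volume.prod volume) := h3.prod (MeasurePreserving.id _)
  exact h4.comp (h2.comp h1)

lemma mp_re (n r : ℕ) : MeasurePreserving
    (fun w : ((Fin r → ℝ) × (Fin r → ℝ)) × (Fin r → Fin n → ℝ × ℝ) =>
      ((w.1.1, (w.2, w.1.2)) : PYT n r)) volume volume := by
  have h1 := measurePreserving_prodAssoc (volume : Measure (Fin r → ℝ)) (volume : Measure (Fin r → ℝ))
    (volume : Measure (Fin r → Fin n → ℝ × ℝ))
  have h2 : MeasurePreserving (Prod.map id Prod.swap : _ → PYT n r)
    ((volume : Measure (Fin r → ℝ)).prod ((volume : Measure (Fin r → ℝ)).prod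
      (volume : Measure (Fin r → Fin n → ℝ × ℝ)))) (volume.prod (volume.prod volume)) :=
    (MeasurePreserving.id _).prod Measure.measurePreserving_swap
  exact h2.comp h1

lemma mp_rot (n r : ℕ) : MeasurePreserving
    (fun w : ((Fin r → ℝ) × (Fin r → ℝ)) × (Fin r → Fin n → ℝ × ℝ) =>
      (((w.1.2, - w.1.1), w.2) : ((Fin r → ℝ) × (Fin r → ℝ)) × (Fin r → Fin n → ℝ × ℝ)))
      volume volume := by
  have h1 : MeasurePreserving (Prod.map id Neg.neg : (Fin r → ℝ) × (Fin r → ℝ) → _)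
    (volume.prod volume) (volume.prod volume) :=
    (MeasurePreserving.id _).prod (Measure.measurePreserving_neg _)
  have h2 := h1.comp (Measure.measurePreserving_swap (μ := (volume : Measure (Fin r → ℝ)))
    (ν := (volume : Measure (Fin r → ℝ))))
  exact h2.prod (MeasurePreserving.id (volume : Measure (Fin r → Fin n → ℝ × ℝ)))

def psi1 {n r : ℕ} (i : Fin (n + 1)) (x : Fin r → Fin (n + 1) → ℝ × ℝ) : PYT n r :=
  (fun j => (x j i).1, (fun j a => x j (i.succAbove a), fun j => (x j i).2))

def psi2 {n r : ℕ} (i : Fin (n + 1)) (x : Fin r → Fin (n + 1) → ℝ × ℝ) : PYT n r :=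
  (fun j => (x j i).2, (fun j a => x j (i.succAbove a), fun j => -(x j i).1))

lemma psi1_mp {n r : ℕ} (i : Fin (n + 1)) : MeasurePreserving (psi1 (r := r) i) volume volume :=
  (mp_re n r).comp (mp_base n r i)

lemma psi2_mp {n r : ℕ} (i : Fin (n + 1)) : MeasurePreserving (psi2 (r := r) i) volume volume :=
  (mp_re n r).comp ((mp_rot n r).comp (mp_base n r i))

lemma omg_succ {n : ℕ} (i : Fin (n + 1)) (x y : Fin (n + 1) → ℝ × ℝ) :
    omg x y = ((x i).1 * (y i).2 - (x i).2 * (y i).1) +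
      omg (fun a => x (i.succAbove a)) (fun a => y (i.succAbove a)) := by
  unfold omg
  rw [Fin.sum_univ_succAbove _ i]

lemma exists_max {n : ℕ} (u : Fin (n + 1) → ℝ × ℝ) : ∃ i, |(u i).1| = ‖u‖ ∨ |(u i).2| = ‖u‖ := by
  obtain ⟨i, -, hi⟩ := Finset.exists_max_image Finset.univ (fun i => ‖u i‖) ⟨0, Finset.mem_univ _⟩
  have : ‖u‖ = ‖u i‖ := le_antisymm
    ((pi_norm_le_iff_of_nonneg (norm_nonneg _)).2 fun j => hi j (Finset.mem_univ _)) (norm_le_pi_norm u i)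
  refine ⟨i, ?_⟩
  rw [this, Prod.norm_def]
  rcases max_choice ‖(u i).1‖ ‖(u i).2‖ with h | h
  · left; rw [h]; rfl
  · right; rw [h]; rfl

lemma fiber_bound {n r : ℕ} {R L : ℝ} (hR : 0 < R) (hL : 0 < L) (c : Fin (r + 1) → Fin (r + 1) → ℝ)
    {V : ENNReal} (hV : ∀ c', volume (VS n r (2 * R) L c') ≤ V) (u : Fin (n + 1) → ℝ × ℝ) (hu : u ≠ 0) :
    volume {x : Fin r → Fin (n + 1) → ℝ × ℝ | (Fin.cons u x : Fin (r + 1) → _) ∈ VS (n + 1) (r + 1) R L c} ≤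
      ENNReal.ofReal (2 * R) ^ r * (ENNReal.ofReal (L / ‖u‖) ^ r * V) := by
  obtain ⟨i, hi⟩ := exists_max u
  have hu0 : ‖u‖ ≠ 0 := norm_ne_zero_iff.2 hu
  have hu' : ‖(fun a => u (i.succAbove a))‖ ≤ ‖u‖ :=
    (pi_norm_le_iff_of_nonneg (norm_nonneg _)).2 fun a => norm_le_pi_norm u _
  have hR' : ∀ {x : Fin (n + 1) → ℝ × ℝ}, ‖x‖ ≤ R → |(x i).1| ≤ R ∧ |(x i).2| ≤ R ∧
      ‖(fun a => x (i.succAbove a))‖ ≤ R := fun {x} hx =>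
    ⟨(norm_fst_le _).trans ((norm_le_pi_norm x i).trans hx),
      (norm_snd_le _).trans ((norm_le_pi_norm x i).trans hx),
      (pi_norm_le_iff_of_nonneg hR.le).2 fun a => (norm_le_pi_norm x _).trans hx⟩
  rcases hi with hi | hi
  · have hα : (u i).1 ≠ 0 := by rw [← abs_ne_zero, hi]; exact hu0
    rw [← hi] at hu' ⊢
    have := IS_bound (β := (u i).2) hR hL hα hu' (fun j => c 0 j.succ) (fun a b => c a.succ b.succ) hV
    refine le_trans ?_ this
    rw [← (psi1_mp i).measure_preimage (IS_closed _ _ _ _ _ _ _ _ _).measurableSet.nullMeasurableSet]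
    refine measure_mono fun x hx => ?_
    obtain ⟨h1, h2⟩ := hx
    refine ⟨fun j => (hR' (h1 j.succ)).1, fun j => (hR' (h1 j.succ)).2.2, fun j => ?_, fun a b hab => ?_⟩
    · have := h2 0 j.succ (Fin.succ_pos j)
      simp only [Fin.cons_zero, Fin.cons_succ] at this
      rw [omg_succ i] at this
      exact this
    · have := h2 a.succ b.succ (Fin.succ_lt_succ_iff.2 hab)
      simp only [Fin.cons_succ] at this
      rw [omg_succ i] at this
      exact this
  · have hα : (u i).2 ≠ 0 := by rw [← abs_ne_zero, hi]; exact hu0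
    rw [← hi] at hu' ⊢
    have := IS_bound (β := -(u i).1) hR hL hα hu' (fun j => c 0 j.succ) (fun a b => c a.succ b.succ) hV
    refine le_trans ?_ this
    rw [← (psi2_mp i).measure_preimage (IS_closed _ _ _ _ _ _ _ _ _).measurableSet.nullMeasurableSet]
    refine measure_mono fun x hx => ?_
    obtain ⟨h1, h2⟩ := hx
    refine ⟨fun j => (hR' (h1 j.succ)).2.1, fun j => (hR' (h1 j.succ)).2.2, fun j => ?_, fun a b hab => ?_⟩
    · have := h2 0 j.succ (Fin.succ_pos j)
      simp only [Fin.cons_zero, Fin.cons_succ] at this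
      rw [omg_succ i] at this
      simp only [psi2]
      convert this using 1
      ring
    · have := h2 a.succ b.succ (Fin.succ_lt_succ_iff.2 hab)
      simp only [Fin.cons_succ] at this
      rw [omg_succ i] at this
      simp only [psi2]
      convert this using 1
      ring

lemma vol_zero (N : ℕ) (hN : N ≠ 0) : volume ({0} : Set (Fin N → ℝ × ℝ)) = 0 := by
  have : ({0} : Set (Fin N → ℝ × ℝ)) = Set.univ.pi fun _ => {0} := by
    ext x; simp [funext_iff]
  rw [this, volume_pi_pi]
  have h2 : volume ({0} : Set (ℝ × ℝ)) = 0 := by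
    have : ({0} : Set (ℝ × ℝ)) = {0} ×ˢ {0} := by ext x; simp [Prod.ext_iff]
    rw [this, Measure.volume_eq_prod, Measure.prod_prod]; simp
  simp [h2, hN]

lemma fr_N (N : ℕ) : Module.finrank ℝ (Fin N → ℝ × ℝ) = N * 2 := by
  rw [Module.finrank_pi_fintype]; simp [Module.finrank_prod]

lemma radial {N r e : ℕ} (h : N * 2 = r + (e + 1)) : ∃ C : ENNReal, C ≠ ⊤ ∧ ∀ R : ℝ, 0 < R →
    ∫⁻ u in Metric.closedBall (0 : Fin N → ℝ × ℝ) R, ENNReal.ofReal (‖u‖⁻¹ ^ r) ≤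
      C * ENNReal.ofReal R ^ (e + 1) := by
  have hN : N ≠ 0 := by omega
  haveI : NeZero N := ⟨hN⟩
  let b := volume (Metric.ball (0 : Fin N → ℝ × ℝ) 1)
  have hb : b ≠ ⊤ := measure_ball_lt_top.ne
  refine ⟨ENNReal.ofReal (2 ^ r) * b * ∑' s : ℕ, ENNReal.ofReal ((1/2) ^ s), ?_, fun R hR => ?_⟩
  · exact ENNReal.mul_ne_top (ENNReal.mul_ne_top ENNReal.ofReal_ne_top hb)
      (summable_geometric_of_lt_one (by norm_num) (by norm_num)).tsum_ofReal_ne_top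
  have h0 : ∀ᵐ u : Fin N → ℝ × ℝ, u ≠ 0 := by
    rw [ae_iff]; simpa using vol_zero N hN
  calc ∫⁻ u in Metric.closedBall (0 : Fin N → ℝ × ℝ) R, ENNReal.ofReal (‖u‖⁻¹ ^ r)
      ≤ ∫⁻ u : Fin N → ℝ × ℝ, ∑' s : ℕ, (Metric.closedBall (0 : Fin N → ℝ × ℝ) (R * (1/2) ^ s)).indicator
          (fun _ => ENNReal.ofReal ((R * (1/2) ^ (s + 1))⁻¹ ^ r)) u := by
        rw [← lintegral_indicator measurableSet_closedBall]
        refine lintegral_mono_ae ?_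
        filter_upwards [h0] with u hu
        by_cases huR : u ∈ Metric.closedBall (0 : Fin N → ℝ × ℝ) R
        · rw [Set.indicator_of_mem huR]
          rw [mem_closedBall_zero_iff] at huR
          have hu1 : 0 < ‖u‖ := norm_pos_iff.2 hu
          obtain ⟨s, hs1, hs2⟩ := exists_nat_pow_near_of_lt_one (x := ‖u‖ / R) (y := (1/2 : ℝ)) (by positivity)
            ((div_le_one hR).2 huR) (by norm_num) (by norm_num)
          rw [lt_div_iff₀ hR] at hs1
          rw [div_le_iff₀ hR] at hs2
          refine le_trans ?_ (ENNReal.le_tsum s)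
          rw [Set.indicator_of_mem (by rw [mem_closedBall_zero_iff]; linarith)]
          apply ENNReal.ofReal_le_ofReal
          gcongr
          linarith
        · rw [Set.indicator_of_notMem huR]; exact zero_le
    _ = ∑' s : ℕ, ENNReal.ofReal ((R * (1/2) ^ (s + 1))⁻¹ ^ r) *
          (ENNReal.ofReal ((R * (1/2) ^ s) ^ (N * 2)) * b) := by
        rw [lintegral_tsum]
        · refine tsum_congr fun s => ?_
          rw [lintegral_indicator measurableSet_closedBall, setLIntegral_const,
            Measure.addHaar_closedBall _ _ (by positivity)]
          rw [fr_N]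
        · exact fun s => (measurable_const.indicator measurableSet_closedBall).aemeasurable
    _ ≤ ∑' s : ℕ, (ENNReal.ofReal (2 ^ r) * b * ENNReal.ofReal R ^ (e + 1)) * ENNReal.ofReal ((1/2) ^ s) := by
        refine ENNReal.tsum_le_tsum fun s => ?_
        rw [← mul_assoc, ← ENNReal.ofReal_mul (by positivity), mul_right_comm _ b, mul_right_comm _ b,
          ← ENNReal.ofReal_pow hR.le, ← ENNReal.ofReal_mul (by positivity), ← ENNReal.ofReal_mul (by positivity)]
        gcongr ENNReal.ofReal ?_ * b
        rw [h]
        have e1 : (R * (1/2 : ℝ) ^ (s + 1))⁻¹ ^ r * (R * (1/2) ^ s) ^ (r + (e + 1)) =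
            2 ^ r * R ^ (e + 1) * ((1/2) ^ s) ^ (e + 1) := by
          have : (R * (1/2 : ℝ) ^ (s + 1))⁻¹ = 2 * (R * (1/2) ^ s)⁻¹ := by
            rw [pow_succ]; field_simp
          have hne : (R * (1/2 : ℝ) ^ s) ≠ 0 := by positivity
          rw [this, pow_add, mul_pow, mul_assoc, ← mul_assoc (((R * (1/2 : ℝ) ^ s))⁻¹ ^ r), ← mul_pow,
            inv_mul_cancel₀ hne, one_pow, one_mul, mul_pow, mul_assoc]
        rw [e1]
        gcongr
        calc ((1/2 : ℝ) ^ s) ^ (e + 1) ≤ ((1/2 : ℝ) ^ s) ^ 1 :=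
              pow_le_pow_of_le_one (by positivity) (pow_le_one₀ (by norm_num) (by norm_num)) (by omega)
          _ = _ := pow_one _
    _ = _ := by rw [ENNReal.tsum_mul_left]; ring

theorem VS_bound (s r : ℕ) {L : ℝ} (hL : 0 < L) : ∃ C : ENNReal, C ≠ ⊤ ∧ ∀ R : ℝ, 0 < R → ∀ c,
    volume (VS (s + r) r R L c) ≤ C * ENNReal.ofReal R ^ (r * (r + 1 + 2 * s)) := by
  induction r with
  | zero =>
    refine ⟨1, ENNReal.one_ne_top, fun R hR c => ?_⟩
    refine (measure_mono (Set.subset_univ _)).trans ?_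
    simp [volume_pi]
  | succ r ih =>
    obtain ⟨C, hC, hCb⟩ := ih
    obtain ⟨D, hD, hDb⟩ := radial (N := s + r + 1) (r := r) (e := r + 1 + 2 * s) (by ring)
    let q := r * (r + 1 + 2 * s)
    refine ⟨2 ^ r * ENNReal.ofReal L ^ r * C * 2 ^ q * D, by finiteness, fun R hR c => ?_⟩
    let V := C * ENNReal.ofReal (2 * R) ^ q
    have hV : ∀ c', volume (VS (s + r) r (2 * R) L c') ≤ V := hCb (2 * R) (by positivity)
    have hmp := (volume_preserving_piFinSuccAbove (fun _ : Fin (r + 1) => Fin (s + r + 1) → ℝ × ℝ) 0).symm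
    have hcl := (VS_closed (s + r + 1) (r + 1) R L c).measurableSet
    rw [show s + (r + 1) = s + r + 1 from rfl, ← hmp.measure_preimage hcl.nullMeasurableSet,
      Measure.volume_eq_prod, Measure.prod_apply (hmp.measurable hcl)]
    have h0 : ∀ᵐ u : Fin (s + r + 1) → ℝ × ℝ, u ≠ 0 := by
      rw [ae_iff]; simpa using vol_zero (s + r + 1) (by omega)
    calc ∫⁻ u : Fin (s + r + 1) → ℝ × ℝ, volume (Prod.mk u ⁻¹' ((MeasurableEquiv.piFinSuccAbove
            (fun _ : Fin (r + 1) => Fin (s + r + 1) → ℝ × ℝ) 0).symm ⁻¹' VS (s + r + 1) (r + 1) R L c))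
        ≤ ∫⁻ u, (Metric.closedBall (0 : Fin (s + r + 1) → ℝ × ℝ) R).indicator (fun u =>
          (ENNReal.ofReal (2 * R) ^ r * ENNReal.ofReal L ^ r * V) * ENNReal.ofReal (‖u‖⁻¹ ^ r)) u := by
          refine lintegral_mono_ae ?_
          filter_upwards [h0] with u hu
          have hset : (Prod.mk u ⁻¹' ((MeasurableEquiv.piFinSuccAbove
            (fun _ : Fin (r + 1) => Fin (s + r + 1) → ℝ × ℝ) 0).symm ⁻¹' VS (s + r + 1) (r + 1) R L c)) =
            {x : Fin r → Fin (s + r + 1) → ℝ × ℝ | (Fin.cons u x : Fin (r + 1) → _) ∈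
              VS (s + r + 1) (r + 1) R L c} := by
            ext x
            simp only [Set.mem_preimage]
            have : (MeasurableEquiv.piFinSuccAbove
              (fun _ : Fin (r + 1) => Fin (s + r + 1) → ℝ × ℝ) 0).symm (u, x) = Fin.cons u x := by
              simp [MeasurableEquiv.piFinSuccAbove, Fin.insertNthEquiv, Fin.insertNth_zero]
            rw [this]; rfl
          rw [hset]
          by_cases huR : u ∈ Metric.closedBall (0 : Fin (s + r + 1) → ℝ × ℝ) R
          · rw [Set.indicator_of_mem huR]
            refine (fiber_bound hR hL c hV u hu).trans (le_of_eq ?_)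
            rw [div_eq_mul_inv, ENNReal.ofReal_mul hL.le, mul_pow, ← ENNReal.ofReal_pow (by positivity) (p := ‖u‖⁻¹)]
            ring
          · rw [Set.indicator_of_notMem huR]
            have : {x : Fin r → Fin (s + r + 1) → ℝ × ℝ | (Fin.cons u x : Fin (r + 1) → _) ∈
              VS (s + r + 1) (r + 1) R L c} = ∅ := by
              ext x
              simp only [Set.mem_empty_iff_false, iff_false]
              intro hx
              apply huR
              rw [mem_closedBall_zero_iff]
              exact hx.1 0
            rw [this, measure_empty]
      _ = (ENNReal.ofReal (2 * R) ^ r * ENNReal.ofReal L ^ r * V) *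
          ∫⁻ u in Metric.closedBall (0 : Fin (s + r + 1) → ℝ × ℝ) R, ENNReal.ofReal (‖u‖⁻¹ ^ r) := by
          rw [lintegral_indicator measurableSet_closedBall, lintegral_const_mul']
          finiteness
      _ ≤ (ENNReal.ofReal (2 * R) ^ r * ENNReal.ofReal L ^ r * V) *
          (D * ENNReal.ofReal R ^ (r + 1 + 2 * s + 1)) := by
          gcongr
          exact hDb R hR
      _ = _ := by
          have e2 : ENNReal.ofReal (2 * R) = 2 * ENNReal.ofReal R := by
            rw [ENNReal.ofReal_mul (by norm_num)]; simp
          have e3 : (r + 1) * (r + 1 + 1 + 2 * s) = r + q + (r + 1 + 2 * s + 1) := by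
            simp only [q]; ring
          rw [e3]
          simp only [V]
          rw [e2, mul_pow, mul_pow, pow_add, pow_add]
          ring

end

section

open Filter Topology Pointwise Bornology

def eS (n : ℕ) : Fin n ⊕ Fin n ≃ Fin (2 * n) := finSumFinEquiv.trans (finCongr (two_mul n).symm)

lemma eS_inl {n : ℕ} (i : Fin n) : ((eS n (Sum.inl i) : Fin (2 * n)) : ℕ) = i := by simp [eS]
lemma eS_inr {n : ℕ} (i : Fin n) : ((eS n (Sum.inr i) : Fin (2 * n)) : ℕ) = n + i := by
  simp [eS, add_comm]

def cv {n : ℕ} (v : Fin (2 * n) → ℝ) : Fin n → ℝ × ℝ :=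
  fun i => (v (eS n (Sum.inl i)), v (eS n (Sum.inr i)))

lemma cv_mp (n : ℕ) : MeasurePreserving (cv (n := n)) volume volume := by
  have h1 := (volume_measurePreserving_piCongrLeft (fun _ => ℝ) (eS n)).symm
  have h2 := volume_measurePreserving_sumPiEquivProdPi (fun _ : Fin n ⊕ Fin n => ℝ)
  have h3 := (volume_measurePreserving_arrowProdEquivProdArrow ℝ ℝ (Fin n)).symm
  exact h3.comp (h2.comp h1)

lemma cv_mp' (n r : ℕ) : MeasurePreserving (fun (x : Fin r → Fin (2 * n) → ℝ) j => cv (x j)) volume volume :=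
  volume_preserving_pi (fun _ => cv_mp n)

lemma symp_eq {n : ℕ} (v w : Fin (2 * n) → ℝ) : symp n v w = omg (cv v) (cv w) := by
  unfold symp omg
  simp only [dotProduct, Matrix.mulVec, Jmat]
  rw [← Equiv.sum_comp (eS n), Fintype.sum_sum_type, ← Finset.sum_add_distrib]
  refine Finset.sum_congr rfl fun i _ => ?_
  rw [← Equiv.sum_comp (eS n), ← Equiv.sum_comp (eS n) (fun x => _ * w x), Fintype.sum_sum_type, Fintype.sum_sum_type]
  simp only [eS_inl, eS_inr]
  have h1 : ∀ j : Fin n, ¬ ((i : ℕ) + n = j) := fun j => by omega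
  have h2 : ∀ j : Fin n, ¬ ((j : ℕ) + n = i) := fun j => by omega
  have h3 : ∀ j : Fin n, ((i : ℕ) + n = n + j) ↔ i = j := fun j => by rw [Fin.ext_iff]; omega
  have h4 : ∀ j : Fin n, ¬ (n + (j : ℕ) + n = i) := fun j => by omega
  have h5 : ∀ j : Fin n, ¬ (n + (i : ℕ) + n = j) := fun j => by omega
  have h6 : ∀ j : Fin n, ((j : ℕ) + n = n + i) ↔ i = j := fun j => by rw [Fin.ext_iff]; omega
  have h7 : ∀ j : Fin n, ¬ (n + (i : ℕ) + n = n + j) := fun j => by omega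
  have h8 : ∀ j : Fin n, ¬ (n + (j : ℕ) + n = n + i) := fun j => by omega
  simp [h1, h2, h3, h4, h5, h6, h7, h8, cv]
  ring

lemma symp_cont {n : ℕ} {X : Type*} [TopologicalSpace X] {f g : X → Fin (2 * n) → ℝ}
    (hf : Continuous f) (hg : Continuous g) : Continuous fun x => symp n (f x) (g x) := by
  unfold symp
  simp only [dotProduct, Matrix.mulVec]
  fun_prop

/-- bounding sets -/
def AS (n : ℕ) (R L : ℝ) (r : ℕ) : Set (Fin r → Fin (2 * n) → ℝ) :=
  {x | (∀ j l, |x j l| ≤ R) ∧ ∀ i j, i ≠ j → |symp n (x i) (x j)| ≤ L}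

lemma AS_meas (n : ℕ) (R L : ℝ) (r : ℕ) : MeasurableSet (AS n R L r) := by
  apply IsClosed.measurableSet
  simp only [AS, Set.ofPred_and, Set.ofPred_forall]
  refine IsClosed.inter ?_ ?_
  · exact isClosed_iInter fun j => isClosed_iInter fun l => isClosed_le (by fun_prop) continuous_const
  · exact isClosed_iInter fun j => isClosed_iInter fun l => isClosed_iInter fun _ =>
      isClosed_le (symp_cont (by fun_prop) (by fun_prop)).abs continuous_const

lemma AS_bound (n r : ℕ) (hr : r ≤ n) {L : ℝ} (hL : 0 < L) : ∃ C : ENNReal, C ≠ ⊤ ∧ ∀ R : ℝ, 0 < R →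
    volume (AS n R L r) ≤ C * ENNReal.ofReal R ^ (r * (r + 1 + 2 * (n - r))) := by
  obtain ⟨C, hC, hb⟩ := VS_bound (n - r) r (L := 2 * L) (by positivity)
  rw [Nat.sub_add_cancel hr] at hb
  refine ⟨C, hC, fun R hR => (?_ : _ ≤ _).trans (hb R hR (fun _ _ => - L))⟩
  rw [← (cv_mp' n r).measure_preimage (VS_closed _ _ _ _ _).measurableSet.nullMeasurableSet]
  refine measure_mono fun x hx => ⟨fun j => ?_, fun i j hij => ?_⟩
  · rw [pi_norm_le_iff_of_nonneg hR.le]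
    intro i
    simp only [cv, Prod.norm_def, Real.norm_eq_abs]
    exact max_le (hx.1 _ _) (hx.1 _ _)
  · have := abs_le.1 (hx.2 i j hij.ne)
    rw [symp_eq] at this
    exact ⟨this.1, by linarith [this.2]⟩

lemma le_enorm2 {d : ℕ} (v : Fin d → ℝ) (i : Fin d) : |v i| ≤ enorm2 v := by
  unfold enorm2
  apply Real.le_sqrt_of_sq_le
  rw [sq_abs]
  exact Finset.single_le_sum (f := fun i => (v i) ^ 2) (fun i _ => sq_nonneg _) (Finset.mem_univ i)

lemma g_bound {m : ℕ} (g : SLR m) : ∃ D : ℝ, 1 ≤ D ∧ ∀ v : Fin m → ℝ, ∀ T,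
    enorm2 ((g : Matrix (Fin m) (Fin m) ℝ).mulVec v) < T → ∀ l, |v l| ≤ D * T := by
  refine ⟨1 + ∑ i, ∑ j, |((g⁻¹ : SLR m) : Matrix (Fin m) (Fin m) ℝ) i j|, ?_, fun v T h l => ?_⟩
  · have : 0 ≤ ∑ i, ∑ j, |((g⁻¹ : SLR m) : Matrix (Fin m) (Fin m) ℝ) i j| := by positivity
    linarith
  set w := (g : Matrix (Fin m) (Fin m) ℝ).mulVec v with hw
  have hv : v = ((g⁻¹ : SLR m) : Matrix (Fin m) (Fin m) ℝ).mulVec w := by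
    rw [hw, Matrix.mulVec_mulVec, ← Matrix.SpecialLinearGroup.coe_mul, inv_mul_cancel]
    simp
  have hT : 0 < T := lt_of_le_of_lt (Real.sqrt_nonneg _) h
  rw [hv]
  simp only [Matrix.mulVec, dotProduct]
  calc |∑ j, ((g⁻¹ : SLR m) : Matrix (Fin m) (Fin m) ℝ) l j * w j|
      ≤ ∑ j, |((g⁻¹ : SLR m) : Matrix (Fin m) (Fin m) ℝ) l j| * T := by
        refine (Finset.abs_sum_le_sum_abs _ _).trans (Finset.sum_le_sum fun j _ => ?_)
        rw [abs_mul]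
        gcongr
        exact (le_enorm2 w j).trans h.le
    _ = (∑ j, |((g⁻¹ : SLR m) : Matrix (Fin m) (Fin m) ℝ) l j|) * T := by rw [Finset.sum_mul]
    _ ≤ _ := by
        gcongr
        have := Finset.single_le_sum (f := fun i => ∑ j, |((g⁻¹ : SLR m) : Matrix (Fin m) (Fin m) ℝ) i j|)
          (fun i _ => by positivity) (Finset.mem_univ l)
        linarith

lemma EgT_open (n k : ℕ) (g : SLR (2*n)) (a b : Pairs k → ℝ) (T : ℝ) : IsOpen (EgT n k g a b T) := by
  simp only [EgT, Set.ofPred_and, Set.ofPred_forall]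
  refine IsOpen.inter ?_ ?_
  · exact isOpen_iInter_of_finite fun p => isOpen_Ioo.preimage (symp_cont (by fun_prop) (by fun_prop))
  · refine isOpen_iInter_of_finite fun l => isOpen_lt ?_ continuous_const
    unfold enorm2
    simp only [Matrix.mulVec, dotProduct]
    fun_prop

lemma EgT_vol (n k : ℕ) (g : SLR (2*n)) (a b : Pairs k → ℝ) (T : ℝ) : volume (EgT n k g a b T) ≠ ⊤ := by
  obtain ⟨D, -, hD⟩ := g_bound g
  refine ne_top_of_le_ne_top (measure_closedBall_lt_top (μ := volume)
    (x := (0 : Fin k → Fin (2 * n) → ℝ)) (r := max 0 (D * T))).ne (measure_mono fun v hv => ?_)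
  rw [mem_closedBall_zero_iff, pi_norm_le_iff_of_nonneg (le_max_left _ _)]
  intro i
  rw [pi_norm_le_iff_of_nonneg (le_max_left _ _)]
  exact fun l => (hD _ _ (hv.2 i) l).trans (le_max_right _ _)

lemma EgT_proj (n k : ℕ) (g : SLR (2*n)) (a b : Pairs k → ℝ) : ∃ D : ℝ, 1 ≤ D ∧ ∃ L : ℝ, 0 < L ∧
    ∀ T, ∀ r, ∀ σ : Fin r ↪ Fin k, ∀ v ∈ EgT n k g a b T, (fun j => v (σ j)) ∈ AS n (D * T) L r := by
  obtain ⟨D, hD1, hD⟩ := g_bound g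
  refine ⟨D, hD1, 1 + ∑ p, (|a p| + |b p|), ?_, fun T r σ v hv => ⟨fun j l => hD _ _ (hv.2 _) l, ?_⟩⟩
  · have : 0 ≤ ∑ p, (|a p| + |b p|) := by positivity
    linarith
  have key : ∀ i j : Fin k, i < j → |symp n (v i) (v j)| ≤ 1 + ∑ p, (|a p| + |b p|) := by
    intro i j hij
    have h1 := hv.1 ⟨(i, j), hij⟩
    have h2 := Finset.single_le_sum (f := fun p : Pairs k => |a p| + |b p|)
          (fun i _ => by positivity) (Finset.mem_univ ⟨(i, j), hij⟩)
    simp only at h1 h2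
    have h3 := neg_abs_le (a ⟨(i, j), hij⟩)
    have h4 := le_abs_self (b ⟨(i, j), hij⟩)
    have h5 := abs_nonneg (a ⟨(i, j), hij⟩)
    have h6 := abs_nonneg (b ⟨(i, j), hij⟩)
    rw [abs_le]
    exact ⟨by linarith [h1.1], by linarith [h1.2]⟩
  intro i j hij
  rcases lt_or_gt_of_ne (fun h => hij (σ.injective h)) with h | h
  · exact key _ _ h
  · rw [symp_eq, omg_comm, abs_neg, ← symp_eq]
    exact key _ _ h

lemma Phi_eq {m k : ℕ} (E : Set (Fin k → Fin m → ℝ)) (h : SLR m) :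
    (Nat.card {v : Fin k → (Fin m → ℤ) | (fun i => (h : Matrix (Fin m) (Fin m) ℝ).mulVec
                (fun j => ((v i j : ℤ) : ℝ))) ∈ E} : ℝ) =
    (Av (sT k) (E.indicator 1) (QuotientGroup.mk h)).toReal := by
  rw [Av_mk (sT_eq k)]
  have h1 : ∑' v : Fin k → Fin m → ℤ, E.indicator (1 : (Fin k → Fin m → ℝ) → ENNReal) (sT k h v) =
      ∑' v : {v : Fin k → Fin m → ℤ | sT k h v ∈ E}, 1 := by
    rw [tsum_subtype {v : Fin k → Fin m → ℤ | sT k h v ∈ E} (fun _ => (1 : ENNReal))]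
    rfl
  rw [h1, ENNReal.tsum_set_one]
  change (Nat.card {v : Fin k → Fin m → ℤ | sT k h v ∈ E} : ℝ) = _
  rw [Nat.card_coe_set_eq, Set.ncard_def]
  generalize Set.encard {v : Fin k → Fin m → ℤ | sT k h v ∈ E} = q
  induction q using ENat.recTopCoe with
  | top => simp
  | coe q => simp

end

/-- Proposition 4.6 (mean of the rank-`k` Siegel transform): for `2n ≥ (k/2)² + 3`,
`∫ χ̃_{E_{g,T}} dμ = vol_{2nk}(E_{g,T}) + O_g(T^{2n(k-1) - (k-1)(k-2)})`. -/
theorem stmt9 (n k : ℕ) (hk : 1 ≤ k) (hn : 1 ≤ n)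
    (hnk : ((k : ℝ)/2)^2 + 3 ≤ (2*n : ℝ))
    (a b : Pairs k → ℝ) (hab : ∀ p, a p < b p) (g : SLR (2*n)) :
    ∀ μ : Measure (Xspace (2*n)), IsProbabilityMeasure μ →
      (∀ γ : SLR (2*n), Measure.map (fun x => γ • x) μ = μ) →
      ∃ C > (0:ℝ), ∃ T0 > (0:ℝ), ∀ T ≥ T0,
        ∀ Φ : Xspace (2*n) → ℝ,
          (∀ h : SLR (2*n), Φ (QuotientGroup.mk h) =
            (Nat.card {v : Fin k → (Fin (2*n) → ℤ) |
              (fun i => (h : Matrix (Fin (2*n)) (Fin (2*n)) ℝ).mulVec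
                (fun j => ((v i j : ℤ) : ℝ))) ∈ EgT n k g a b T} : ℝ)) →
          |(∫ x, Φ x ∂μ) - (volume (EgT n k g a b T)).toReal|
            ≤ C * T ^ (((2*n*(k-1) : ℕ) : ℝ) - (((k-1)*(k-2) : ℕ) : ℝ)) := by
  intro μ hμ hinv
  have hnk' : k * k + 12 ≤ 8 * n := by
    have : (k : ℝ) * k + 12 ≤ 8 * n := by nlinarith
    exact_mod_cast this
  have hkn : k ≤ n := by
    zify at hnk' ⊢
    by_contra! h
    have h1 : (n : ℤ) + 1 ≤ k := h
    nlinarith [sq_nonneg ((k : ℤ) - 4)]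
  have he : ∀ r, r < k → (k - r) * r + 2 ≤ 2 * n := by
    intro r hr
    obtain ⟨s, rfl⟩ := Nat.exists_eq_add_of_lt hr
    have : r + s + 1 - r = s + 1 := by omega
    rw [this]
    zify at hnk' ⊢
    nlinarith [sq_nonneg ((r : ℤ) - s - 1)]
  obtain ⟨K, hK, hrog⟩ := rogers_bound (k := k) (m := 2 * n) (by omega) he
  obtain ⟨D, hD1, L, hL, hproj⟩ := EgT_proj n k g a b
  have hA : ∀ r : ℕ, ∃ C : ENNReal, C ≠ ⊤ ∧ (r < k → ∀ R : ℝ, 0 < R →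
      volume (AS n R L r) ≤ C * ENNReal.ofReal R ^ (r * (r + 1 + 2 * (n - r)))) := by
    intro r
    by_cases hr : r < k
    · obtain ⟨C, hC, h⟩ := AS_bound n r (by omega) hL
      exact ⟨C, hC, fun _ => h⟩
    · exact ⟨0, by simp, fun h => absurd h hr⟩
  choose Cr hCr hAr using hA
  obtain ⟨q, rfl⟩ : ∃ q, k = q + 1 := ⟨k - 1, by omega⟩
  set P := q * (q + 1 + 2 * (n - q)) with hP
  have hexp : ∀ r, r < q + 1 → r * (r + 1 + 2 * (n - r)) ≤ P := by
    intro r hr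
    obtain ⟨s, hs⟩ := Nat.exists_eq_add_of_le (show r ≤ q by omega)
    obtain ⟨t, ht⟩ := Nat.exists_eq_add_of_le (show q ≤ n by omega)
    have h1 : n - r = s + t := by omega
    have h2 : n - q = t := by omega
    rw [hP, h1, h2, hs]
    have : r * s ≤ r * s + s * (s + 1 + 2 * t) + r * s := by nlinarith
    nlinarith
  have hPr : (((2*n*(q+1-1) : ℕ) : ℝ) - (((q+1-1)*(q+1-2) : ℕ) : ℝ)) = (P : ℝ) := by
    obtain ⟨t, ht⟩ := Nat.exists_eq_add_of_le (show q ≤ n by omega)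
    have h2 : n - q = t := by omega
    rw [hP, h2, ht]
    rcases q with _ | q
    · simp
    · simp only [Nat.add_sub_cancel, show q + 1 + 1 - 2 = q by omega]
      push_cast
      ring
  let B : ENNReal := K * ∑ r ∈ Finset.range (q + 1), Cr r * ENNReal.ofReal D ^ P
  have hB : B ≠ ⊤ := by
    refine ENNReal.mul_ne_top hK (ENNReal.sum_ne_top.2 fun r _ => ENNReal.mul_ne_top (hCr r) ?_)
    finiteness
  refine ⟨B.toReal + 1, by positivity, 1, one_pos, fun T hT Φ hΦ => ?_⟩
  have hT0 : 0 < T := by linarith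
  set E := EgT n (q + 1) g a b T with hE
  have hEm : MeasurableSet E := (EgT_open _ _ _ _ _ _).measurableSet
  have hEv : volume E ≠ ⊤ := EgT_vol _ _ _ _ _ _
  obtain ⟨hlo, hhi⟩ := hrog μ hinv E (AS n (D * T) L) hEm (fun r => AS_meas _ _ _ _)
    (fun r _ σ v hv => hproj T r σ v hv)
  have hsum : K * ∑ r ∈ Finset.range (q + 1), volume (AS n (D * T) L r) ≤ B * ENNReal.ofReal (T ^ P) := by
    rw [mul_assoc, Finset.sum_mul]
    gcongr with r hr
    rw [Finset.mem_range] at hr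
    refine (hAr r hr (D * T) (by positivity)).trans ?_
    rw [mul_assoc, ← ENNReal.ofReal_pow (by positivity), ← ENNReal.ofReal_pow (by positivity),
      ← ENNReal.ofReal_mul (by positivity), ← mul_pow]
    gcongr
    · nlinarith
    · exact hexp r hr
  set I := ∫⁻ x, Av (sT (q + 1)) (E.indicator 1) x ∂μ with hI
  have hfin : B * ENNReal.ofReal (T ^ P) ≠ ⊤ := ENNReal.mul_ne_top hB ENNReal.ofReal_ne_top
  have hhi2 : I ≤ volume E + B * ENNReal.ofReal (T ^ P) := hhi.trans (by gcongr)
  have hItop : I ≠ ⊤ := ne_top_of_le_ne_top (ENNReal.add_ne_top.2 ⟨hEv, hfin⟩) hhi2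
  have hmeas : Measurable (Av (sT (m := 2 * n) (q + 1)) (E.indicator 1)) :=
    Av_meas (sT_eq _) sT_meas (measurable_one.indicator hEm)
  have hΦ2 : Φ = fun x => (Av (sT (q + 1)) (E.indicator 1) x).toReal := by
    funext x
    induction x using QuotientGroup.induction_on with
    | H h => rw [hΦ h, Phi_eq]
  have hint : ∫ x, Φ x ∂μ = I.toReal := by
    rw [hΦ2]
    exact integral_toReal hmeas.aemeasurable (ae_lt_top hmeas hItop)
  rw [hint, hPr, Real.rpow_natCast]
  have h1 := ENNReal.toReal_mono hItop hlo
  have h2 := ENNReal.toReal_mono (ENNReal.add_ne_top.2 ⟨hEv, hfin⟩) hhi2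
  rw [ENNReal.toReal_add hEv hfin, ENNReal.toReal_mul, ENNReal.toReal_ofReal (by positivity)] at h2
  rw [abs_of_nonneg (by linarith)]
  have : 0 ≤ T ^ P := by positivity
  linarith
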